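/- arXiv:math/0507369 — 2 statements merged into one kernel-verified Lean document; each statement's English description precedes it below -/
import Mathlib

section
/- Fix b ∈ ℝ^m and let Ψ : ℤ^n → ℝ⁺ satisfy Ψ(a) → 0 as |a| → ∞, with n + m > 2. Assume Schmidt's theorem: if Σ_{a ∈ ℤ^n} Ψ(a)^m = ∞ then W_{n,m}^b(Ψ) has full nm-dimensional Lebesgue measure in [0,1)^{n×m}. Let f be a dimension function such that r^{-nm} f(r) is monotonic and g(r) := r^{-(n-1)m} f(r) is a dimension function. Then Σ_{a ∈ ℤ^n \ {0}} g(Ψ(a)/|a|)·|a|^m = ∞ implies H^f(W_{n,m}^b(Ψ)) = H^f([0,1)^{n×m}). -/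
open MeasureTheory Set Filter
open scoped ENNReal

def IsDimFun (f : ℝ → ℝ) : Prop :=
  ContinuousOn f (Set.Ici 0) ∧ MonotoneOn f (Set.Ici 0) ∧
    (∀ r, 0 ≤ r → 0 ≤ f r) ∧ Filter.Tendsto f (nhdsWithin 0 (Set.Ioi 0)) (nhds 0)

noncomputable def hMeasure {X : Type*} [EMetricSpace X] [MeasurableSpace X] [BorelSpace X]
    (f : ℝ → ℝ) : Measure X :=
  Measure.mkMetric (fun d => ENNReal.ofReal (f d.toReal))

/-- `|a| := max |a_i|` for an integer vector. -/
def anorm {n : ℕ} (a : Fin n → ℤ) : ℕ := Finset.univ.sup fun i => (a i).natAbs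

/-- Distance from a real number to the nearest integer. -/
noncomputable def intDist (x : ℝ) : ℝ := |x - round x|

/-- The set `W_{n,m}^b(Ψ)` of `X ∈ [0,1)^{n×m}` such that
`‖a · x_j - b_j‖ < Ψ(a)` for all `j` for infinitely many `a ∈ ℤ^n`. -/
def W (n m : ℕ) (b : Fin m → ℝ) (Ψ : (Fin n → ℤ) → ℝ) :
    Set (EuclideanSpace ℝ (Fin m × Fin n)) :=
  {X | (∀ ji, X ji ∈ Set.Ico (0:ℝ) 1) ∧
    {a : Fin n → ℤ |
      ∀ j : Fin m, intDist ((∑ i, (a i : ℝ) * X (j, i)) - b j) < Ψ a}.Infinite}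

/-- The unit box `[0,1)^{n×m}`. -/
def box (n m : ℕ) : Set (EuclideanSpace ℝ (Fin m × Fin n)) :=
  {X | ∀ ji, X ji ∈ Set.Ico (0:ℝ) 1}



noncomputable def shearMap {n m : ℕ} (a : Fin n → ℝ) (i0 : Fin n) :
    ((Fin m × Fin n) → ℝ) →ₗ[ℝ] ((Fin m × Fin n) → ℝ) where
  toFun x := fun q => if q.2 = i0 then ∑ i, a i / a i0 * x (q.1, i) else x q
  map_add' x y := by
    ext q
    by_cases h : q.2 = i0 <;> simp [h, mul_add, Finset.sum_add_distrib]
  map_smul' c x := by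
    ext q
    by_cases h : q.2 = i0
    · simp only [h, if_true, Pi.smul_apply, smul_eq_mul, RingHom.id_apply, Finset.mul_sum]
      exact Finset.sum_congr rfl fun i _ => by ring
    · simp [h]

lemma shear_det {n m : ℕ} (a : Fin n → ℝ) (i0 : Fin n) (ha : a i0 ≠ 0) :
    LinearMap.det (shearMap (m := m) a i0) = 1 := by
  classical
  rw [← LinearMap.det_toMatrix']
  set M := LinearMap.toMatrix' (shearMap (m := m) a i0) with hM
  have hMij : ∀ p q, M p q = if p.2 = i0 then (if p.1 = q.1 then a q.2 / a i0 else 0) else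
      (if p = q then 1 else 0) := by
    intro p q
    rw [hM, LinearMap.toMatrix'_apply]
    obtain ⟨p1, p2⟩ := p
    obtain ⟨q1, q2⟩ := q
    by_cases h : p2 = i0
    · by_cases h2 : p1 = q1 <;> simp [shearMap, h, h2, Pi.single_apply]
    · simp [shearMap, h, Pi.single_apply]
  have hT : M.BlockTriangular (fun q : Fin m × Fin n => if q.2 = i0 then (0:ℕ) else 1) := by
    intro p q hpq
    rw [hMij]
    by_cases h1 : p.2 = i0
    · simp [h1] at hpq
    · by_cases h2 : q.2 = i0
      · have : p ≠ q := by rintro rfl; exact h1 h2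
        simp [h1, this]
      · simp [h1, h2] at hpq
  rw [hT.det]
  apply Finset.prod_eq_one
  intro k _
  have : M.toSquareBlock (fun q : Fin m × Fin n => if q.2 = i0 then (0:ℕ) else 1) k = 1 := by
    ext ⟨p, hp⟩ ⟨q, hq⟩
    simp only [Matrix.toSquareBlock_def, Matrix.of_apply, hMij, Matrix.one_apply, Subtype.mk.injEq]
    by_cases h1 : p.2 = i0
    · have h2 : q.2 = i0 := by
        by_contra h2
        simp [h1] at hp; simp [h2] at hq; omega
      have : p = q ↔ p.1 = q.1 := ⟨fun h => by rw [h], fun h => Prod.ext h (h1.trans h2.symm)⟩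
      simp [h1, h2, this, ha]
    · simp [h1]
  rw [this, Matrix.det_one]

def slab {n m : ℕ} (a : Fin n → ℝ) (i0 : Fin n) (p : (Fin m × Fin n) → ℝ) (R h : ℝ) :
    Set ((Fin m × Fin n) → ℝ) :=
  {x | (∀ j i, i ≠ i0 → |x (j, i) - p (j, i)| ≤ R) ∧
    ∀ j, |∑ i, a i * (x (j, i) - p (j, i))| ≤ |a i0| * h}

lemma slab_eq {n m : ℕ} (a : Fin n → ℝ) (i0 : Fin n) (ha : a i0 ≠ 0)
    (p : (Fin m × Fin n) → ℝ) (R h : ℝ) :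
    slab a i0 p R h = (shearMap a i0) ⁻¹' (Icc
      (fun q => shearMap a i0 p q - if q.2 = i0 then h else R)
      (fun q => shearMap a i0 p q + if q.2 = i0 then h else R)) := by
  have key : ∀ (x : (Fin m × Fin n) → ℝ) j, (|∑ i, a i * (x (j, i) - p (j, i))| ≤ |a i0| * h ↔
      |shearMap a i0 x (j, i0) - shearMap a i0 p (j, i0)| ≤ h) := by
    intro x j
    have : ∑ i, a i * (x (j, i) - p (j, i)) =
        a i0 * (shearMap a i0 x (j, i0) - shearMap a i0 p (j, i0)) := by
      simp only [shearMap, LinearMap.coe_mk, AddHom.coe_mk, if_true, mul_sub, Finset.mul_sum,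
        ← Finset.sum_sub_distrib]
      exact Finset.sum_congr rfl fun i _ => by field_simp
    rw [this, abs_mul, mul_le_mul_iff_right₀ (abs_pos.2 ha)]
  have key2 : ∀ (x : (Fin m × Fin n) → ℝ) j i, i ≠ i0 → shearMap a i0 x (j, i) = x (j, i) := by
    intro x j i hi
    simp [shearMap, hi]
  ext x
  simp only [slab, mem_ofPred_eq, mem_preimage, mem_Icc, Pi.le_def]
  constructor
  · rintro ⟨h1, h2⟩
    rw [← forall_and]
    rintro ⟨j, i⟩
    by_cases hi : i = i0
    · subst hi
      have := (key x j).1 (h2 j)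
      rw [abs_le] at this
      simp only [if_true]
      constructor <;> linarith
    · have := h1 j i hi
      rw [abs_le] at this
      simp only [hi, if_false, key2 _ _ _ hi]
      constructor <;> linarith
  · intro H
    rw [← forall_and] at H
    refine ⟨fun j i hi => ?_, fun j => (key x j).2 ?_⟩
    · have := H (j, i)
      simp only [hi, if_false, key2 _ _ _ hi] at this
      rw [abs_le]; constructor <;> linarith
    · have := H (j, i0)
      simp only [if_true] at this
      rw [abs_le]; constructor <;> linarith

lemma slab_meas {n m : ℕ} (a : Fin n → ℝ) (i0 : Fin n) (ha : a i0 ≠ 0)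
    (p : (Fin m × Fin n) → ℝ) (R h : ℝ) : MeasurableSet (slab a i0 p R h) := by
  rw [slab_eq a i0 ha]
  exact (LinearMap.continuous_of_finiteDimensional _).measurable measurableSet_Icc

lemma slab_vol {n m : ℕ} (a : Fin n → ℝ) (i0 : Fin n) (ha : a i0 ≠ 0)
    (p : (Fin m × Fin n) → ℝ) {R h : ℝ} (hR : 0 ≤ R) (hh : 0 ≤ h) :
    volume (slab a i0 p R h) = ENNReal.ofReal ((2 * R) ^ ((n - 1) * m) * (2 * h) ^ m) := by
  rw [slab_eq a i0 ha, Measure.addHaar_preimage_linearMap _ (by rw [shear_det a i0 ha]; exact one_ne_zero),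
    shear_det a i0 ha, Real.volume_Icc_pi, ← ENNReal.ofReal_prod_of_nonneg]
  · simp only [inv_one, abs_one, ENNReal.ofReal_one, one_mul]
    congr 1
    have : ∀ q : Fin m × Fin n, (shearMap a i0 p q + if q.2 = i0 then h else R) -
      (shearMap a i0 p q - if q.2 = i0 then h else R) = if q.2 = i0 then 2 * h else 2 * R := by
      intro q; split_ifs <;> ring
    simp only [this]
    rw [Fintype.prod_prod_type]
    simp only [Finset.prod_ite, Finset.prod_const, Finset.filter_eq', Finset.filter_ne',
      Finset.mem_univ, if_true, Finset.card_singleton, Finset.card_erase_of_mem, Finset.card_univ, Fintype.card_fin, pow_one]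
    rw [mul_pow, ← pow_mul, mul_comm]
  · intro q _
    split_ifs <;> linarith


lemma avg_lemma {ι β κ : Type*} [Fintype ι] [Countable κ] (u : Finset β) (T : β → Set (ι → ℝ))
    (hTm : ∀ b ∈ u, MeasurableSet (T b)) (hTd : (u : Set β).PairwiseDisjoint T)
    (D : β → ℝ≥0∞) (y : κ → ι → ℝ) (r : κ → ℝ) (φ : κ → ℝ≥0∞)
    (s' : ℝ) (B : ℝ≥0∞) (hB0 : B ≠ 0) (hBt : B ≠ ⊤)
    (h : ∑' i, ((∑ b ∈ u, D b * volume (Metric.closedBall (y i) (2 * r i) ∩ T b)) +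
      φ i / B * volume (Metric.closedBall (y i) (2 * s'))) < ∑ b ∈ u, D b * volume (T b)) :
    ∃ b ∈ u, ∃ x ∈ T b, (∀ i, x ∈ Metric.closedBall (y i) (2 * r i) → r i < s') ∧
      ∑' i, (Metric.closedBall (y i) (2 * s')).indicator (fun _ => φ i) x ≤ B * D b := by
  by_contra hcon
  push Not at hcon
  refine absurd h (not_lt.2 ?_)
  have hpt : ∀ b ∈ u, ∀ x ∈ T b, D b ≤ ∑' i,
      ((Metric.closedBall (y i) (2 * r i)).indicator (fun _ => D b) x +
        (Metric.closedBall (y i) (2 * s')).indicator (fun _ => φ i / B) x) := by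
    intro b hb x hx
    by_cases h1 : ∀ i, x ∈ Metric.closedBall (y i) (2 * r i) → r i < s'
    · have h2 := hcon b hb x hx h1
      have h3 : D b ≤ (∑' i, (Metric.closedBall (y i) (2 * s')).indicator (fun _ => φ i) x) / B := by
        rw [ENNReal.le_div_iff_mul_le (Or.inl hB0) (Or.inl hBt), mul_comm]
        exact h2.le
      refine h3.trans ?_
      rw [div_eq_mul_inv, ← ENNReal.tsum_mul_right]
      refine ENNReal.tsum_le_tsum fun i => ?_
      refine le_trans ?_ le_add_self
      by_cases hxi : x ∈ Metric.closedBall (y i) (2 * s') <;> simp [hxi, div_eq_mul_inv]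
    · push Not at h1
      obtain ⟨i, hi, _⟩ := h1
      refine le_trans ?_ (ENNReal.le_tsum i)
      refine le_trans ?_ le_self_add
      simp [hi]
  have hbint : ∀ b ∈ u, D b * volume (T b) ≤ ∑' i,
      (D b * volume (Metric.closedBall (y i) (2 * r i) ∩ T b) +
        φ i / B * volume (Metric.closedBall (y i) (2 * s') ∩ T b)) := by
    intro b hb
    calc D b * volume (T b) = ∫⁻ _ in T b, D b := by simp
      _ ≤ ∫⁻ x in T b, ∑' i,
      ((Metric.closedBall (y i) (2 * r i)).indicator (fun _ => D b) x +
        (Metric.closedBall (y i) (2 * s')).indicator (fun _ => φ i / B) x) :=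
          setLIntegral_mono' (hTm b hb) (hpt b hb)
      _ = _ := by
        rw [lintegral_tsum]
        · congr 1
          ext i
          rw [lintegral_add_left, lintegral_indicator_const, lintegral_indicator_const,
            Measure.restrict_apply, Measure.restrict_apply]
          all_goals first
            | exact Metric.isClosed_closedBall.measurableSet
            | exact measurable_const.indicator Metric.isClosed_closedBall.measurableSet
        · intro i
          exact ((measurable_const.indicator Metric.isClosed_closedBall.measurableSet).add
            (measurable_const.indicator Metric.isClosed_closedBall.measurableSet)).aemeasurable
  refine (Finset.sum_le_sum hbint).trans ?_
  rw [← Summable.tsum_finsetSum (fun _ _ => ENNReal.summable)]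
  refine ENNReal.tsum_le_tsum fun i => ?_
  rw [Finset.sum_add_distrib, ← Finset.mul_sum]
  gcongr
  rw [← measure_biUnion_finset]
  · exact measure_mono (by simp)
  · intro b hb c hc hbc
    exact (hTd hb hc hbc).mono inter_subset_right inter_subset_right
  · intro b hb
    exact Metric.isClosed_closedBall.measurableSet.inter (hTm b hb)

/-- two overlapping balls -/
lemma ball_inter_vol {ι : Type*} [Fintype ι] (z y : ι → ℝ) {ρ r : ℝ} (hr : 0 < r) (hρ : r < ρ)
    (hne : (Metric.closedBall z ρ ∩ Metric.closedBall y (2 * r)).Nonempty) :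
    ENNReal.ofReal (r ^ Fintype.card ι) ≤
      volume (Metric.closedBall z ρ ∩ Metric.closedBall y (4 * r)) := by
  obtain ⟨x, hxz, hxy⟩ := hne
  have hρ0 : 0 < ρ := hr.trans hρ
  set w : ι → ℝ := fun i => x i + (r / (2 * ρ)) * (z i - x i) with hw
  have hrρ : r / (2 * ρ) * ρ = r / 2 := by field_simp
  have h0 : 0 ≤ r / (2 * ρ) := by positivity
  have h1 : r / (2 * ρ) ≤ 1 := by rw [div_le_one (by linarith)]; linarith
  rw [Metric.mem_closedBall, dist_pi_le_iff (by positivity)] at hxz hxy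
  have hsub : Metric.closedBall w (r / 2) ⊆
      Metric.closedBall z ρ ∩ Metric.closedBall y (4 * r) := by
    intro v hv
    rw [Metric.mem_closedBall, dist_pi_le_iff (by positivity)] at hv
    rw [mem_inter_iff, Metric.mem_closedBall, Metric.mem_closedBall,
      dist_pi_le_iff (by positivity), dist_pi_le_iff (by positivity)]
    refine ⟨fun i => ?_, fun i => ?_⟩
    · have a1 := hv i
      have a2 := hxz i
      rw [Real.dist_eq] at *
      have e : v i - z i = (v i - w i) + (1 - r / (2 * ρ)) * (x i - z i) := by simp only [hw]; ring
      rw [e]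
      refine (abs_add_le _ _).trans ?_
      rw [abs_mul, abs_of_nonneg (by linarith : 0 ≤ 1 - r / (2 * ρ))]
      nlinarith
    · have a1 := hv i
      have a2 := hxz i
      have a3 := hxy i
      rw [Real.dist_eq] at *
      have e : v i - y i = (v i - w i) + (x i - y i) + (-(r / (2 * ρ))) * (x i - z i) := by
        simp only [hw]; ring
      rw [e]
      refine (abs_add_three _ _ _).trans ?_
      rw [abs_mul, abs_neg, abs_of_nonneg h0]
      nlinarith
  refine le_trans (le_of_eq ?_) (measure_mono hsub)
  rw [Real.volume_pi_closedBall _ (by positivity)]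
  congr 2
  ring


lemma tube_subset {n m : ℕ} (a : Fin n → ℝ) (i0 : Fin n) (ha : a i0 ≠ 0)
    (hmax : ∀ i, |a i| ≤ |a i0|) (z : (Fin m × Fin n) → ℝ) {ρ Υ : ℝ} (hΥ : 0 < Υ) (hle : Υ ≤ ρ) :
    slab a i0 z (ρ / (2 * n)) (Υ / 2) ⊆ Metric.closedBall z ρ := by
  intro x hx
  obtain ⟨h1, h2⟩ := hx
  have hρ : 0 < ρ := hΥ.trans_le hle
  have hn : (0:ℝ) < n := by
    have : 0 < n := i0.pos
    exact_mod_cast this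
  have hn1 : (1:ℝ) ≤ n := by
    have : 0 < n := i0.pos
    exact_mod_cast this
  rw [Metric.mem_closedBall, dist_pi_le_iff hρ.le]
  rintro ⟨j, i⟩
  rw [Real.dist_eq]
  by_cases hi : i = i0
  · subst hi
    have ha' := abs_pos.2 ha
    have e := h2 j
    rw [← Finset.add_sum_erase _ _ (Finset.mem_univ i)] at e
    have e2 : |∑ k ∈ Finset.univ.erase i, a k * (x (j, k) - z (j, k))| ≤ |a i| * (ρ / 2) := by
      refine (Finset.abs_sum_le_sum_abs _ _).trans ?_
      have : ∀ k ∈ Finset.univ.erase i, |a k * (x (j, k) - z (j, k))| ≤ |a i| * (ρ / (2 * n)) := by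
        intro k hk
        rw [abs_mul]
        exact mul_le_mul (hmax k) (h1 j k (Finset.ne_of_mem_erase hk)) (abs_nonneg _) ha'.le
      refine (Finset.sum_le_sum this).trans ?_
      rw [Finset.sum_const, nsmul_eq_mul]
      have hc : ((Finset.univ.erase i).card : ℝ) ≤ n := by
        have := Finset.card_le_univ (Finset.univ.erase i)
        rw [Fintype.card_fin] at this
        exact_mod_cast this
      calc _ ≤ (n:ℝ) * (|a i| * (ρ / (2 * n))) := by gcongr
        _ = _ := by field_simp
    have e3 : |a i * (x (j, i) - z (j, i))| ≤ |a i| * ρ := by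
      have := abs_sub_abs_le_abs_sub (a i * (x (j, i) - z (j, i)))
        (-∑ k ∈ Finset.univ.erase i, a k * (x (j, k) - z (j, k)))
      rw [sub_neg_eq_add, abs_neg] at this
      nlinarith
    rw [abs_mul] at e3
    exact le_of_mul_le_mul_left e3 ha'
  · refine (h1 j i hi).trans ?_
    rw [div_le_iff₀ (by positivity)]
    nlinarith

lemma tube_vol {n m : ℕ} (a : Fin n → ℝ) (i0 : Fin n) (ha : a i0 ≠ 0)
    (z : (Fin m × Fin n) → ℝ) {ρ Υ : ℝ} (hΥ : 0 < Υ) (hρ : 0 < ρ) :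
    ENNReal.ofReal ((ρ / Υ) ^ m) * volume (slab a i0 z (ρ / (2 * n)) (Υ / 2)) =
      ENNReal.ofReal (ρ ^ (n * m) / n ^ ((n - 1) * m)) := by
  have hn0 : 0 < n := i0.pos
  have hn : (0:ℝ) < n := by exact_mod_cast hn0
  rw [slab_vol a i0 ha z (by positivity) (by positivity), ← ENNReal.ofReal_mul (by positivity)]
  congr 1
  have e : n * m = (n - 1) * m + m := by
    obtain ⟨k, rfl⟩ : ∃ k, n = k + 1 := ⟨n - 1, by omega⟩
    simp [add_mul]
  have e2 : 2 * (ρ / (2 * n)) = ρ / n := by field_simp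
  have e3 : 2 * (Υ / 2) = Υ := by ring
  rw [e, e2, e3, pow_add, div_pow, div_pow]
  field_simp

lemma tube_inter_vol {n m : ℕ} (a : Fin n → ℝ) (i0 : Fin n) (ha : a i0 ≠ 0)
    (z y : (Fin m × Fin n) → ℝ) {R Υ r : ℝ} (hΥ : 0 < Υ) (hr : 0 < r) :
    volume (Metric.closedBall y (2 * r) ∩ slab a i0 z R (Υ / 2)) ≤
      ENNReal.ofReal ((4 * r) ^ ((n - 1) * m) * Υ ^ m) := by
  classical
  set p : (Fin m × Fin n) → ℝ := fun q =>
    if q.2 = i0 then y q + (∑ i, a i * (z (q.1, i) - y (q.1, i))) / a i0 else y q with hp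
  have hpe : ∀ j, ∑ i, a i * p (j, i) = ∑ i, a i * z (j, i) := by
    intro j
    have : ∀ i, a i * p (j, i) = a i * y (j, i) +
        if i = i0 then (∑ i, a i * (z (j, i) - y (j, i))) else 0 := by
      intro i
      by_cases h : i = i0
      · subst h
        simp only [hp, if_true]
        field_simp
      · simp [hp, h]
    simp only [this, Finset.sum_add_distrib, Finset.sum_ite_eq', Finset.mem_univ, if_true, mul_sub,
      Finset.sum_sub_distrib]
    ring
  have hsub : Metric.closedBall y (2 * r) ∩ slab a i0 z R (Υ / 2) ⊆
      slab a i0 p (2 * r) (Υ / 2) := by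
    rintro x ⟨hx, hx1, hx2⟩
    rw [Metric.mem_closedBall, dist_pi_le_iff (by positivity)] at hx
    refine ⟨fun j i hi => ?_, fun j => ?_⟩
    · have := hx (j, i)
      rw [Real.dist_eq] at this
      simpa [hp, hi] using this
    · have := hx2 j
      simp only [mul_sub, Finset.sum_sub_distrib, hpe] at this ⊢
      exact this
  refine (measure_mono hsub).trans ?_
  rw [slab_vol a i0 ha p (by positivity) (by positivity)]
  apply ENNReal.ofReal_le_ofReal
  have e1 : 2 * (2 * r) = 4 * r := by ring
  have e3 : 2 * (Υ / 2) = Υ := by ring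
  rw [e1, e3]

lemma nm_eq {n m : ℕ} (hn : 0 < n) : n * m = (n - 1) * m + m := by
  obtain ⟨k, rfl⟩ : ∃ k, n = k + 1 := ⟨n - 1, by omega⟩
  simp [add_mul]

lemma tube_key {n m : ℕ} (a : Fin n → ℝ) (i0 : Fin n) (ha : a i0 ≠ 0)
    (hmax : ∀ i, |a i| ≤ |a i0|)
    (z y : (Fin m × Fin n) → ℝ) {ρ Υ r K : ℝ} (hΥ : 0 < Υ) (hle : Υ ≤ ρ) (hr : 0 < r) (hK : 0 < K)
    {f g : ℝ → ℝ} (hA : AntitoneOn (fun r => f r / r ^ (n * m)) (Set.Ioi 0))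
    (hg : MonotoneOn g (Set.Ici 0))
    (hgdef : ∀ r > (0:ℝ), g r = f r / r ^ ((n - 1) * m))
    (hρ : ρ ^ m = g Υ / K) (hfr : K * r ^ (n * m) ≤ f r) :
    ENNReal.ofReal ((ρ / Υ) ^ m) *
        volume (Metric.closedBall y (2 * r) ∩ slab a i0 z (ρ / (2 * n)) (Υ / 2)) ≤
      ENNReal.ofReal (4 ^ (n * m) * (f r / K) / r ^ (n * m)) *
        volume (Metric.closedBall z ρ ∩ Metric.closedBall y (4 * r)) := by
  have hn0 : 0 < n := i0.pos
  have hn1 : (1:ℝ) ≤ n := by exact_mod_cast hn0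
  have hρ0 : 0 < ρ := hΥ.trans_le hle
  have hsub := tube_subset a i0 ha hmax z hΥ hle
  have hcard : Fintype.card (Fin m × Fin n) = n * m := by simp [mul_comm]
  rcases (Metric.closedBall y (2 * r) ∩ slab a i0 z (ρ / (2 * n)) (Υ / 2)).eq_empty_or_nonempty
    with hemp | hne
  · rw [hemp]; simp
  by_cases hρr : ρ ≤ r
  · obtain ⟨x, hxy, hxz⟩ := hne
    have hxz := hsub hxz
    have hball : Metric.closedBall z ρ ⊆ Metric.closedBall y (4 * r) := by
      intro w hw
      rw [Metric.mem_closedBall] at *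
      have := dist_triangle4 w z x y
      rw [dist_comm z x] at this
      linarith
    rw [inter_eq_left.2 hball]
    calc _ ≤ ENNReal.ofReal ((ρ / Υ) ^ m) * volume (slab a i0 z (ρ / (2 * n)) (Υ / 2)) := by
          gcongr; exact inter_subset_right
      _ = ENNReal.ofReal (ρ ^ (n * m) / n ^ ((n - 1) * m)) := tube_vol a i0 ha z hΥ hρ0
      _ ≤ ENNReal.ofReal 1 * ENNReal.ofReal ((2 * ρ) ^ (n * m)) := by
          rw [← ENNReal.ofReal_mul zero_le_one]
          apply ENNReal.ofReal_le_ofReal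
          rw [one_mul]
          refine (div_le_self (by positivity) (one_le_pow₀ hn1)).trans ?_
          gcongr; linarith
      _ ≤ _ := by
          rw [Real.volume_pi_closedBall _ hρ0.le, hcard]
          gcongr
          rw [le_div_iff₀ (by positivity), one_mul]
          have h4 : (1:ℝ) ≤ 4 ^ (n * m) := one_le_pow₀ (by norm_num)
          have : r ^ (n * m) ≤ f r / K := by rw [le_div_iff₀ hK]; linarith
          have h0 : 0 ≤ r ^ (n * m) := by positivity
          nlinarith
  · push Not at hρr
    have hfr0 : 0 ≤ f r / K := by
      apply div_nonneg _ hK.le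
      exact le_trans (by positivity) hfr
    have hv := ball_inter_vol z y hr hρr (hne.mono fun x hx => ⟨hsub hx.2, hx.1⟩)
    rw [hcard] at hv
    have hmain : ENNReal.ofReal ((ρ / Υ) ^ m) *
        volume (Metric.closedBall y (2 * r) ∩ slab a i0 z (ρ / (2 * n)) (Υ / 2)) ≤
        ENNReal.ofReal (4 ^ (n * m) * (f r / K)) := by
      by_cases hrΥ : r ≤ Υ
      · calc _ ≤ ENNReal.ofReal ((ρ / Υ) ^ m) * volume (Metric.closedBall y (2 * r)) := by
              gcongr; exact inter_subset_left
          _ = ENNReal.ofReal ((ρ / Υ) ^ m * (2 * (2 * r)) ^ (n * m)) := by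
              rw [Real.volume_pi_closedBall _ (by positivity), hcard,
                ← ENNReal.ofReal_mul (by positivity)]
          _ ≤ _ := by
              apply ENNReal.ofReal_le_ofReal
              have h1 : (ρ / Υ) ^ m = f Υ / Υ ^ (n * m) / K := by
                rw [div_pow, hρ, hgdef Υ hΥ, nm_eq hn0, pow_add]
                field_simp
              have h2 : f Υ / Υ ^ (n * m) ≤ f r / r ^ (n * m) := hA hr hΥ hrΥ
              rw [h1]
              calc f Υ / Υ ^ (n * m) / K * (2 * (2 * r)) ^ (n * m)
                  ≤ f r / r ^ (n * m) / K * (2 * (2 * r)) ^ (n * m) := by gcongr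
                _ = _ := by
                  rw [← mul_assoc, mul_pow]; field_simp; norm_num
      · push Not at hrΥ
        calc _ ≤ ENNReal.ofReal ((ρ / Υ) ^ m) *
              ENNReal.ofReal ((4 * r) ^ ((n - 1) * m) * Υ ^ m) := by
              gcongr; exact tube_inter_vol a i0 ha z y hΥ hr
          _ = ENNReal.ofReal ((ρ / Υ) ^ m * ((4 * r) ^ ((n - 1) * m) * Υ ^ m)) := by
              rw [← ENNReal.ofReal_mul (by positivity)]
          _ ≤ _ := by
              apply ENNReal.ofReal_le_ofReal
              have h2 : g Υ ≤ g r := hg hΥ.le hr.le hrΥ.le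
              have h3 : (4:ℝ) ^ ((n - 1) * m) ≤ 4 ^ (n * m) := by
                apply pow_le_pow_right₀ (by norm_num)
                rw [nm_eq hn0]; omega
              calc (ρ / Υ) ^ m * ((4 * r) ^ ((n - 1) * m) * Υ ^ m)
                  = 4 ^ ((n - 1) * m) * (r ^ ((n - 1) * m) * (g Υ / K)) := by
                    rw [← hρ, div_pow, mul_pow]; field_simp
                _ ≤ 4 ^ ((n - 1) * m) * (r ^ ((n - 1) * m) * (g r / K)) := by gcongr
                _ = 4 ^ ((n - 1) * m) * (f r / K) := by
                    rw [hgdef r hr]; field_simp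
                _ ≤ _ := by gcongr
    refine hmain.trans ?_
    calc ENNReal.ofReal (4 ^ (n * m) * (f r / K))
        = ENNReal.ofReal (4 ^ (n * m) * (f r / K) / r ^ (n * m)) * ENNReal.ofReal (r ^ (n * m)) := by
          rw [← ENNReal.ofReal_mul (by positivity)]
          congr 1
          field_simp
      _ ≤ _ := by gcongr


lemma vitali_pick {ι τ : Type*} [Fintype ι] (t : Set τ) (z : τ → ι → ℝ) (ρ : τ → ℝ) (R : ℝ)
    (hR : ∀ b ∈ t, ρ b ≤ R) (hpos : ∀ b ∈ t, 0 < ρ b) (S : Set (ι → ℝ))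
    (hS : ∀ᵐ x ∂(volume : Measure (ι → ℝ)), x ∈ S → ∃ b ∈ t, x ∈ Metric.closedBall (z b) (ρ b))
    (V : ℝ≥0∞) (hV : V < volume S) :
    ∃ v : Finset τ, (v : Set τ) ⊆ t ∧
      (v : Set τ).PairwiseDisjoint (fun b => Metric.closedBall (z b) (ρ b)) ∧
      V < ∑ b ∈ v, ENNReal.ofReal ((10 * ρ b) ^ Fintype.card ι) := by
  obtain ⟨u, hut, hud, hucov⟩ := Vitali.exists_disjoint_subfamily_covering_enlargement_closedBall
    t z ρ R hR 5 (by norm_num)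
  have huc : u.Countable := by
    apply hud.countable_of_nonempty_interior
    intro b hb
    exact ⟨z b, Metric.ball_subset_interior_closedBall (Metric.mem_ball_self (hpos b (hut hb)))⟩
  have := huc.to_subtype
  have h1 : volume S ≤ ∑' b : u, ENNReal.ofReal ((10 * ρ b) ^ Fintype.card ι) := by
    calc volume S ≤ volume (⋃ b : u, Metric.closedBall (z b) (5 * ρ b)) := by
          apply measure_mono_ae
          filter_upwards [hS] with x hx hxS
          obtain ⟨b, hb, hxb⟩ := hx hxS
          obtain ⟨c, hc, hbc⟩ := hucov b hb
          exact mem_iUnion.2 ⟨⟨c, hc⟩, hbc hxb⟩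
      _ ≤ ∑' b : u, volume (Metric.closedBall (z b) (5 * ρ b)) := measure_iUnion_le _
      _ = _ := by
          congr 1
          ext b
          have := hpos b (hut b.2)
          rw [Real.volume_pi_closedBall _ (by positivity)]
          congr 2
          ring
  have h2 := hV.trans_le h1
  rw [ENNReal.tsum_eq_iSup_sum, lt_iSup_iff] at h2
  obtain ⟨v, hv⟩ := h2
  refine ⟨v.map (Function.Embedding.subtype _), ?_, ?_, ?_⟩
  · intro b hb
    simp only [Finset.coe_map, Function.Embedding.subtype_apply, mem_image] at hb
    obtain ⟨c, _, rfl⟩ := hb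
    exact hut c.2
  · apply hud.subset
    intro b hb
    simp only [Finset.coe_map, Function.Embedding.subtype_apply, mem_image] at hb
    obtain ⟨c, _, rfl⟩ := hb
    exact c.2
  · rw [Finset.sum_map]
    exact hv

lemma exists_center {n m : ℕ} (a : Fin n → ℤ) (i0 : Fin n) (ha : a i0 ≠ 0) (b : Fin m → ℝ)
    (x : (Fin m × Fin n) → ℝ) {ρ : ℝ} (hρ : 0 ≤ ρ)
    (h : ∀ j, intDist ((∑ i, (a i : ℝ) * x (j, i)) - b j) < |(a i0 : ℝ)| * ρ) :
    ∃ z : (Fin m × Fin n) → ℝ, dist x z ≤ ρ ∧ ∃ p : Fin m → ℤ, ∀ j,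
      ∑ i, (a i : ℝ) * z (j, i) = b j + p j := by
  classical
  have ha' : (a i0 : ℝ) ≠ 0 := by exact_mod_cast ha
  set p : Fin m → ℤ := fun j => round ((∑ i, (a i : ℝ) * x (j, i)) - b j) with hp
  set e : Fin m → ℝ := fun j => (∑ i, (a i : ℝ) * x (j, i)) - b j - p j with he
  have hee : ∀ j, |e j| < |(a i0 : ℝ)| * ρ := h
  refine ⟨fun q => x q - if q.2 = i0 then e q.1 / a i0 else 0, ?_, p, ?_⟩
  · rw [dist_pi_le_iff hρ]
    rintro ⟨j, i⟩
    rw [Real.dist_eq]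
    by_cases hi : i = i0
    · simp only [hi, if_true, sub_sub_cancel, abs_div]
      rw [div_le_iff₀ (abs_pos.2 ha'), mul_comm]
      exact (hee j).le
    · simp [hi, hρ]
  · intro j
    have : ∀ i, (a i : ℝ) * (x (j, i) - if i = i0 then e j / a i0 else 0) =
        a i * x (j, i) - if i = i0 then e j else 0 := by
      intro i
      by_cases hi : i = i0
      · subst hi; simp only [if_true]; field_simp
      · simp [hi]
    simp only [this, Finset.sum_sub_distrib, Finset.sum_ite_eq', Finset.mem_univ, if_true]
    simp only [he]; ring

lemma thin_of {n m : ℕ} (a : Fin n → ℤ) (i0 : Fin n) (hmax : ∀ i, |(a i : ℝ)| ≤ |(a i0 : ℝ)|)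
    (b : Fin m → ℝ) (z x w : (Fin m × Fin n) → ℝ) (p : Fin m → ℤ) {R Υ s : ℝ}
    (hz : ∀ j, ∑ i, (a i : ℝ) * z (j, i) = b j + p j)
    (hx : x ∈ slab (fun i => (a i : ℝ)) i0 z R (Υ / 2)) (hw : dist w x ≤ s)
    (hs : n * (|(a i0 : ℝ)| * s) < |(a i0 : ℝ)| * Υ / 2) (j : Fin m) :
    intDist ((∑ i, (a i : ℝ) * w (j, i)) - b j) < |(a i0 : ℝ)| * Υ := by
  have hs0 : 0 ≤ s := dist_nonneg.trans hw
  rw [dist_pi_le_iff hs0] at hw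
  refine (round_le _ (p j)).trans_lt ?_
  have h1 := hx.2 j
  have h2 : |∑ i, (a i : ℝ) * (w (j, i) - x (j, i))| ≤ n * (|(a i0 : ℝ)| * s) := by
    refine (Finset.abs_sum_le_sum_abs _ _).trans ?_
    have : ∀ k ∈ Finset.univ, |(a k : ℝ) * (w (j, k) - x (j, k))| ≤ |(a i0 : ℝ)| * s := by
      intro k _
      rw [abs_mul]
      exact mul_le_mul (hmax k) (hw (j, k)) (abs_nonneg _) (abs_nonneg _)
    refine (Finset.sum_le_sum this).trans ?_
    simp
  have e : (∑ i, (a i : ℝ) * w (j, i)) - b j - p j =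
      (∑ i, (a i : ℝ) * (w (j, i) - x (j, i))) + ∑ i, (a i : ℝ) * (x (j, i) - z (j, i)) := by
    simp only [mul_sub, Finset.sum_sub_distrib, hz]
    ring
  rw [e]
  refine (abs_add_le _ _).trans_lt ?_
  simp only at h1
  linarith

lemma finite_anorm_lt {n : ℕ} (N : ℕ) : {a : Fin n → ℤ | anorm a < N}.Finite := by
  apply (Set.finite_Icc (fun _ : Fin n => (-(N:ℤ))) (fun _ => (N:ℤ))).subset
  intro a ha
  have : ∀ i, (a i).natAbs < N := fun i =>
    (Finset.le_sup (f := fun i => (a i).natAbs) (Finset.mem_univ i)).trans_lt ha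
  rw [mem_Icc, Pi.le_def, Pi.le_def]
  constructor <;> intro i <;> have := this i <;> omega

lemma exists_anorm {n : ℕ} (hn : 0 < n) (a : Fin n → ℤ) :
    ∃ i0, |(a i0 : ℝ)| = anorm a ∧ ∀ i, |(a i : ℝ)| ≤ |(a i0 : ℝ)| := by
  have : Nonempty (Fin n) := ⟨⟨0, hn⟩⟩
  obtain ⟨i0, _, h⟩ := Finset.exists_mem_eq_sup (Finset.univ : Finset (Fin n))
    Finset.univ_nonempty (fun i => (a i).natAbs)
  have h1 : ∀ i, |(a i : ℝ)| = ((a i).natAbs : ℝ) := fun i => by simp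
  refine ⟨i0, ?_, ?_⟩
  · rw [h1]; unfold anorm; rw [h]
  · intro i
    rw [h1, h1, ← h]
    exact_mod_cast Finset.le_sup (f := fun i => (a i).natAbs) (Finset.mem_univ i)


/-- the invariant of the construction -/
def CubeInv {n m : ℕ} (f : ℝ → ℝ) (c : ℝ) (y : ℕ → (Fin m × Fin n) → ℝ) (r : ℕ → ℝ)
    (x : (Fin m × Fin n) → ℝ) (s K : ℝ) : Prop :=
  (∀ i, (Metric.closedBall (y i) (r i) ∩ Metric.closedBall x s).Nonempty →
    K * r i ^ (n * m) ≤ f (r i)) ∧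
  ∑' i : {i // (Metric.closedBall (y i) (r i) ∩ Metric.closedBall x s).Nonempty},
    ENNReal.ofReal (f (r i)) ≤ ENNReal.ofReal (c * K * s ^ (n * m))

noncomputable def fatR {n : ℕ} (m : ℕ) (g : ℝ → ℝ) (Ψ : (Fin n → ℤ) → ℝ) (K : ℝ) (a : Fin n → ℤ) : ℝ :=
  (g (Ψ a / anorm a) / K) ^ (1 / (m : ℝ))

lemma sum_bound {n m : ℕ} {β κ : Type*} (v : Finset β) (T : β → Set ((Fin m × Fin n) → ℝ))
    (z : β → (Fin m × Fin n) → ℝ) (ρ D : β → ℝ)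
    (hd : (v : Set β).PairwiseDisjoint (fun b => Metric.closedBall (z b) (ρ b)))
    (y : κ → (Fin m × Fin n) → ℝ) (r : κ → ℝ) (f : ℝ → ℝ) {K c C' s s' c1 : ℝ} (hK : 0 < K)
    (hc : 0 < c) (hC' : 0 < C') (hs : 0 < s) (hs' : 0 < s')
    (hr : ∀ i, 0 < r i) (hfr : ∀ i, 0 ≤ f (r i))
    (hkey : ∀ i, ∀ b ∈ v, ENNReal.ofReal (D b) * volume (Metric.closedBall (y i) (2 * r i) ∩ T b) ≤
      ENNReal.ofReal (4 ^ (n * m) * (f (r i) / K) / r i ^ (n * m)) *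
        volume (Metric.closedBall (z b) (ρ b) ∩ Metric.closedBall (y i) (4 * r i)))
    (hsum : ∑' i, ENNReal.ofReal (f (r i)) ≤ ENNReal.ofReal (c * K * s ^ (n * m)))
    (hcc : 32 ^ (n * m) * c + 4 ^ (n * m) / C' < c1)
    (htot : ENNReal.ofReal (c1 * s ^ (n * m)) ≤ ∑ b ∈ v, ENNReal.ofReal (D b) * volume (T b)) :
    ∑' i, ((∑ b ∈ v, ENNReal.ofReal (D b) * volume (Metric.closedBall (y i) (2 * r i) ∩ T b)) +
      ENNReal.ofReal (f (r i)) / ENNReal.ofReal (c * K * C' * s' ^ (n * m)) *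
        volume (Metric.closedBall (y i) (2 * s'))) <
      ∑ b ∈ v, ENNReal.ofReal (D b) * volume (T b) := by
  have hcard : Fintype.card (Fin m × Fin n) = n * m := by simp [mul_comm]
  have hi : ∀ i, ((∑ b ∈ v, ENNReal.ofReal (D b) *
      volume (Metric.closedBall (y i) (2 * r i) ∩ T b)) +
      ENNReal.ofReal (f (r i)) / ENNReal.ofReal (c * K * C' * s' ^ (n * m)) *
        volume (Metric.closedBall (y i) (2 * s'))) ≤
      ENNReal.ofReal (f (r i)) * ENNReal.ofReal (32 ^ (n * m) / K + 4 ^ (n * m) / (c * K * C')) := by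
    intro i
    have hri := hr i
    have hfi := hfr i
    rw [ENNReal.ofReal_add (by positivity) (by positivity), mul_add]
    apply add_le_add
    · refine (Finset.sum_le_sum (hkey i)).trans ?_
      rw [← Finset.mul_sum, ← measure_biUnion_finset]
      · refine (mul_le_mul_right (measure_mono (t := Metric.closedBall (y i) (4 * r i)) (by simp)) _).trans ?_
        rw [Real.volume_pi_closedBall _ (by positivity), hcard, ← ENNReal.ofReal_mul (by positivity),
          ← ENNReal.ofReal_mul (by positivity)]
        apply ENNReal.ofReal_le_ofReal
        apply le_of_eq
        have : (32:ℝ) ^ (n * m) = 4 ^ (n * m) * 8 ^ (n * m) := by rw [← mul_pow]; norm_num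
        rw [this, ← mul_assoc, mul_pow]
        norm_num
        field_simp
      · intro b hb b' hb' hbb'
        exact (hd hb hb' hbb').mono inter_subset_left inter_subset_left
      · intro b hb
        exact Metric.isClosed_closedBall.measurableSet.inter Metric.isClosed_closedBall.measurableSet
    · rw [Real.volume_pi_closedBall _ (by positivity), hcard, ← ENNReal.ofReal_div_of_pos (by positivity),
        ← ENNReal.ofReal_mul (by positivity), ← ENNReal.ofReal_mul (by positivity)]
      apply ENNReal.ofReal_le_ofReal
      apply le_of_eq
      rw [← mul_assoc, mul_pow]
      norm_num
      field_simp
  refine ((ENNReal.tsum_le_tsum hi).trans (b := _)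
    (c := ENNReal.ofReal ((32 ^ (n * m) * c + 4 ^ (n * m) / C') * s ^ (n * m))) ?_).trans_lt
    (lt_of_lt_of_le ?_ htot)
  · rw [ENNReal.tsum_mul_right]
    refine (mul_le_mul_left hsum _).trans ?_
    rw [← ENNReal.ofReal_mul (by positivity)]
    apply ENNReal.ofReal_le_ofReal
    apply le_of_eq
    field_simp
  · have : 0 < s ^ (n * m) := by positivity
    have h32 : 0 < 32 ^ (n * m) * c + 4 ^ (n * m) / C' := by positivity
    have : 0 < c1 := h32.trans hcc
    rw [ENNReal.ofReal_lt_ofReal_iff (by positivity)]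
    gcongr

lemma step {n m : ℕ} (hn : 0 < n) (hm : 0 < m) (b : Fin m → ℝ)
    (Ψ : (Fin n → ℤ) → ℝ) (hΨ0 : ∀ a, 0 ≤ Ψ a)
    (hΨlim : ∀ ε > (0:ℝ), ∃ N : ℕ, ∀ a : Fin n → ℤ, N ≤ anorm a → Ψ a < ε)
    (f g : ℝ → ℝ) (hg : IsDimFun g)
    (hA : AntitoneOn (fun r => f r / r ^ (n * m)) (Set.Ioi 0))
    (hgdef : ∀ r > (0:ℝ), g r = f r / r ^ ((n - 1) * m))
    (hunb : ∀ K > 0, ∃ δ > 0, ∀ r, 0 < r → r ≤ δ → K * r ^ (n * m) ≤ f r)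
    (hfull : ∀ K > 0, ∀ᵐ x ∂(volume : Measure ((Fin m × Fin n) → ℝ)),
      (∀ q, x q ∈ Ico (0:ℝ) 1) → {a : Fin n → ℤ | ∀ j : Fin m,
        intDist ((∑ i, (a i : ℝ) * x (j, i)) - b j) < anorm a * fatR m g Ψ K a}.Infinite)
    {c C' : ℝ} (hc : 0 < c) (hC' : 0 < C')
    (hcc : 32 ^ (n * m) * c + 4 ^ (n * m) / C' < 1 / (2 * 10 ^ (n * m) * n ^ ((n - 1) * m)))
    (y : ℕ → (Fin m × Fin n) → ℝ) (r : ℕ → ℝ) (hr : ∀ i, 0 < r i)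
    (x0 : (Fin m × Fin n) → ℝ) {s K : ℝ} (hs : 0 < s) (hK : 0 < K)
    (hbox : ∀ x ∈ Metric.closedBall x0 s, ∀ q, x q ∈ Ico (0:ℝ) 1)
    (hI : CubeInv f c y r x0 s K) (N : ℕ) {ε : ℝ} (hε : 0 < ε) :
    ∃ x' s' K', 0 < s' ∧ s' ≤ ε ∧ 0 < K' ∧ Metric.closedBall x' s' ⊆ Metric.closedBall x0 s ∧
      CubeInv f c y r x' s' K' ∧
      (∀ i, (Metric.closedBall (y i) (r i) ∩ Metric.closedBall x' s').Nonempty → r i < s') ∧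
      ∃ a : Fin n → ℤ, N ≤ anorm a ∧ ∀ w ∈ Metric.closedBall x' s', ∀ j : Fin m,
        intDist ((∑ i, (a i : ℝ) * w (j, i)) - b j) < Ψ a := by
  classical
  have hcard : Fintype.card (Fin m × Fin n) = n * m := by simp [mul_comm]
  obtain ⟨hgc, hgm, hg0, hglim⟩ := hg
  obtain ⟨δ, hδ, hδK⟩ := hunb K hK
  choose i0 hi0 hmax using exists_anorm hn
  -- smallness of `ρ`
  have hg' : ∀ η > 0, ∃ δ1 > 0, ∀ t, 0 < t → t < δ1 → g t < η := by
    intro η hη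
    have := hglim.eventually (gt_mem_nhds hη)
    rw [eventually_nhdsWithin_iff, Metric.eventually_nhds_iff] at this
    obtain ⟨δ1, h1, h2⟩ := this
    refine ⟨δ1, h1, fun t ht ht' => h2 ?_ ht⟩
    rw [Real.dist_eq, sub_zero, abs_of_pos ht]; exact ht'
  obtain ⟨δ1, hδ1, hgδ1⟩ := hg' (K * (s / 8) ^ m) (by positivity)
  obtain ⟨N1, hN1⟩ := hΨlim (min δ δ1) (lt_min hδ hδ1)
  set N0 := max (max N N1) 1 with hN0
  -- facts about a single `a`
  have hfacts : ∀ a : Fin n → ℤ, N0 ≤ anorm a → 0 < fatR m g Ψ K a →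
      0 < Ψ a / anorm a ∧ Ψ a / anorm a ≤ fatR m g Ψ K a ∧ fatR m g Ψ K a ≤ s / 8 ∧
      fatR m g Ψ K a ^ m = g (Ψ a / anorm a) / K := by
    intro a ha hρ
    have ha1 : (1:ℝ) ≤ anorm a := by
      have : 1 ≤ anorm a := (le_max_right _ _).trans ha
      exact_mod_cast this
    have hgn : 0 ≤ g (Ψ a / anorm a) / K := div_nonneg (hg0 _ (div_nonneg (hΨ0 a) (by linarith))) hK.le
    have hpow : fatR m g Ψ K a ^ m = g (Ψ a / anorm a) / K := by
      unfold fatR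
      rw [one_div, Real.rpow_inv_natCast_pow hgn hm.ne']
    have hΥ : 0 < Ψ a / anorm a := by
      rcases (div_nonneg (hΨ0 a) (by linarith) : 0 ≤ Ψ a / anorm a).lt_or_eq with h | h
      · exact h
      · exfalso
        have hg00 : g 0 ≤ 0 := by
          apply ge_of_tendsto hglim
          filter_upwards [self_mem_nhdsWithin] with t ht
          exact hgm (mem_Ici.2 le_rfl) (mem_Ici.2 (le_of_lt ht)) (le_of_lt ht)
        have : 0 < fatR m g Ψ K a ^ m := by positivity
        rw [hpow, ← h] at this
        have := div_nonpos_of_nonpos_of_nonneg hg00 hK.le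
        linarith
    have hlt := hN1 a ((le_max_right _ _).trans ((le_max_left _ _).trans ha))
    have hle1 : Ψ a / anorm a ≤ Ψ a := div_le_self (hΨ0 a) ha1
    have hΥδ : Ψ a / anorm a ≤ δ := hle1.trans (hlt.le.trans (min_le_left _ _))
    have hΥδ1 : Ψ a / anorm a < δ1 := hle1.trans_lt (hlt.trans_le (min_le_right _ _))
    refine ⟨hΥ, ?_, ?_, hpow⟩
    · have h1 := hδK _ hΥ hΥδ
      rw [← pow_le_pow_iff_left₀ hΥ.le hρ.le hm.ne', hpow, hgdef _ hΥ, le_div_iff₀ hK,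
        le_div_iff₀ (by positivity)]
      rw [nm_eq hn, pow_add] at h1
      linarith
    · rw [← pow_le_pow_iff_left₀ hρ.le (by positivity) hm.ne', hpow, div_le_iff₀ hK]
      linarith [hgδ1 _ hΥ hΥδ1]
  -- the family of balls
  set t : Set ((Fin n → ℤ) × ((Fin m × Fin n) → ℝ)) := {τ | N0 ≤ anorm τ.1 ∧
    τ.2 ∈ Metric.closedBall x0 (s / 2) ∧ ∀ j : Fin m,
    intDist ((∑ i, (τ.1 i : ℝ) * τ.2 (j, i)) - b j) < anorm τ.1 * fatR m g Ψ K τ.1} with ht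
  have ht1 : ∀ τ ∈ t, (1:ℝ) ≤ anorm τ.1 := by
    intro τ hτ
    have : 1 ≤ anorm τ.1 := (le_max_right _ _).trans hτ.1
    exact_mod_cast this
  have htρ : ∀ τ ∈ t, 0 < fatR m g Ψ K τ.1 := by
    intro τ hτ
    have h1 := (abs_nonneg _).trans_lt (hτ.2.2 ⟨0, hm⟩)
    have h2 := ht1 τ hτ
    by_contra h
    push Not at h
    have := mul_nonpos_of_nonneg_of_nonpos (by linarith : (0:ℝ) ≤ anorm τ.1) h
    linarith
  have hai0 : ∀ τ ∈ t, τ.1 (i0 τ.1) ≠ 0 := by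
    intro τ hτ h
    have h2 := ht1 τ hτ
    rw [← hi0, h] at h2
    norm_num at h2
  have hz : ∀ τ : (Fin n → ℤ) × ((Fin m × Fin n) → ℝ), ∃ z : (Fin m × Fin n) → ℝ, τ ∈ t →
      (dist τ.2 z ≤ fatR m g Ψ K τ.1 ∧ ∃ p : Fin m → ℤ, ∀ j,
      ∑ i, (τ.1 i : ℝ) * z (j, i) = b j + p j) := by
    intro τ
    by_cases hτ : τ ∈ t
    · obtain ⟨z, hz⟩ := exists_center τ.1 (i0 τ.1) (hai0 τ hτ) b τ.2 (htρ τ hτ).le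
        (by rw [hi0]; exact hτ.2.2)
      exact ⟨z, fun _ => hz⟩
    · exact ⟨0, fun h => absurd h hτ⟩
  choose z hz using hz
  obtain ⟨v, hvt, hvd, hvs⟩ := vitali_pick t z (fun τ => fatR m g Ψ K τ.1) (s / 8)
    (fun τ hτ => (hfacts τ.1 hτ.1 (htρ τ hτ)).2.2.1) htρ (Metric.closedBall x0 (s / 2))
    (by
      filter_upwards [hfull K hK] with x hx hxS
      have hinf := hx (hbox x (Metric.closedBall_subset_closedBall (by linarith) hxS))
      obtain ⟨a, ha, ha'⟩ := (hinf.sdiff (finite_anorm_lt N0)).nonempty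
      have hmem : (a, x) ∈ t := ⟨not_lt.1 ha', hxS, ha⟩
      exact ⟨(a, x), hmem, (hz _ hmem).1⟩)
    (ENNReal.ofReal (s ^ (n * m) / 2))
    (by
      rw [Real.volume_pi_closedBall _ (by positivity), hcard, ENNReal.ofReal_lt_ofReal_iff (by positivity)]
      have : 0 < s ^ (n * m) := by positivity
      rw [show 2 * (s / 2) = s by ring]
      linarith)
  rw [hcard] at hvs
  -- tubes
  set T : (Fin n → ℤ) × ((Fin m × Fin n) → ℝ) → Set ((Fin m × Fin n) → ℝ) := fun τ =>
    slab (fun i => (τ.1 i : ℝ)) (i0 τ.1) (z τ) (fatR m g Ψ K τ.1 / (2 * n))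
      (Ψ τ.1 / anorm τ.1 / 2) with hT
  set D : (Fin n → ℤ) × ((Fin m × Fin n) → ℝ) → ℝ := fun τ =>
    (fatR m g Ψ K τ.1 / (Ψ τ.1 / anorm τ.1)) ^ m with hD
  have hTsub : ∀ τ ∈ t, T τ ⊆ Metric.closedBall (z τ) (fatR m g Ψ K τ.1) := by
    intro τ hτ
    have hh := hfacts τ.1 hτ.1 (htρ τ hτ)
    exact tube_subset _ _ (by exact_mod_cast hai0 τ hτ) (hmax τ.1) _ hh.1 hh.2.1
  have hDpos : ∀ τ ∈ t, 0 < D τ := by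
    intro τ hτ
    have hh := hfacts τ.1 hτ.1 (htρ τ hτ)
    exact pow_pos (div_pos (htρ τ hτ) hh.1) _
  have htot : ENNReal.ofReal (1 / (2 * 10 ^ (n * m) * n ^ ((n - 1) * m)) * s ^ (n * m)) ≤
      ∑ τ ∈ v, ENNReal.ofReal (D τ) * volume (T τ) := by
    have hn' : (0:ℝ) < n := by exact_mod_cast hn
    have : ∀ τ ∈ v, ENNReal.ofReal (D τ) * volume (T τ) =
        ENNReal.ofReal ((10 * fatR m g Ψ K τ.1) ^ (n * m)) *
          ENNReal.ofReal (1 / (10 ^ (n * m) * n ^ ((n - 1) * m))) := by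
      intro τ hτ
      have hτ := hvt hτ
      have hh := hfacts τ.1 hτ.1 (htρ τ hτ)
      have hρ := htρ τ hτ
      simp only [hD, hT]
      rw [tube_vol _ _ (by exact_mod_cast hai0 τ hτ) _ hh.1 hρ, ← ENNReal.ofReal_mul (by positivity)]
      congr 1
      rw [mul_pow]
      field_simp
    rw [Finset.sum_congr rfl this, ← Finset.sum_mul]
    refine le_trans ?_ (mul_le_mul_left hvs.le _)
    rw [← ENNReal.ofReal_mul (by positivity)]
    apply ENNReal.ofReal_le_ofReal
    apply le_of_eq
    field_simp
  -- choice of `s'`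
  have hs'ex : ∃ s' : ℝ, 0 < s' ∧ s' ≤ ε ∧ s' ≤ s / 4 ∧ ∀ τ ∈ v,
      (n * (|(τ.1 (i0 τ.1) : ℝ)| * s') < |(τ.1 (i0 τ.1) : ℝ)| * (Ψ τ.1 / anorm τ.1) / 2 ∧
      ∀ ρ, 0 < ρ → ρ ≤ s' → C' * K * D τ * ρ ^ (n * m) ≤ f ρ) := by
    have hsmall : ∀ η > (0:ℝ), ∀ᶠ s' in nhdsWithin (0:ℝ) (Ioi 0), s' < η := fun η hη =>
      mem_nhdsWithin_of_mem_nhds (Iio_mem_nhds hη)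
    have hall : ∀ᶠ s' in nhdsWithin (0:ℝ) (Ioi 0), ∀ τ ∈ v,
      (n * (|(τ.1 (i0 τ.1) : ℝ)| * s') < |(τ.1 (i0 τ.1) : ℝ)| * (Ψ τ.1 / anorm τ.1) / 2 ∧
      ∀ ρ, 0 < ρ → ρ ≤ s' → C' * K * D τ * ρ ^ (n * m) ≤ f ρ) := by
      rw [Finset.eventually_all]
      intro τ hτv
      have hτ := hvt hτv
      have hh := hfacts τ.1 hτ.1 (htρ τ hτ)
      have hDp := hDpos τ hτ
      obtain ⟨δ', hδ', hδ'f⟩ := hunb (C' * K * D τ) (by positivity)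
      have hn' : (0:ℝ) < n := by exact_mod_cast hn
      have hA0 : 0 < |(τ.1 (i0 τ.1) : ℝ)| := abs_pos.2 (by exact_mod_cast hai0 τ hτ)
      filter_upwards [hsmall δ' hδ', hsmall ((Ψ τ.1 / anorm τ.1) / (2 * n)) (div_pos hh.1 (by positivity))]
        with s' h1 h2
      refine ⟨?_, fun ρ h3 h4 => hδ'f ρ h3 (h4.trans h1.le)⟩
      rw [lt_div_iff₀ (by positivity)] at h2
      nlinarith
    have := ((hall.and ((hsmall ε hε).and (hsmall (s / 4) (by positivity)))).and
      self_mem_nhdsWithin).exists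
    obtain ⟨s', ⟨h1, h2, h3⟩, h4⟩ := this
    exact ⟨s', h4, h2.le, h3.le, h1⟩
  obtain ⟨s', hs', hs'ε, hs's, hs'v⟩ := hs'ex
  have hbound := sum_bound (κ := {i // (Metric.closedBall (y i) (r i) ∩ Metric.closedBall x0 s).Nonempty})
    v T z (fun τ => fatR m g Ψ K τ.1) D hvd (fun i => y i) (fun i => r i) f hK hc hC' hs hs'
    (fun i => hr i) (fun i => le_trans (mul_nonneg hK.le (pow_nonneg (hr i).le _)) (hI.1 i i.2))
    (by
      intro i τ hτ
      have hτ := hvt hτ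
      have hh := hfacts τ.1 hτ.1 (htρ τ hτ)
      exact tube_key _ _ (by exact_mod_cast hai0 τ hτ) (hmax τ.1) _ _ hh.1 hh.2.1 (hr i) hK hA hgm
        hgdef hh.2.2.2 (hI.1 i i.2))
    hI.2 hcc htot
  obtain ⟨τ, hτv, x, hxT, hx1, hx2⟩ := avg_lemma v T
    (fun τ hτ => slab_meas _ _ (by exact_mod_cast hai0 τ (hvt hτ)) _ _ _)
    (by
      intro τ hτ τ' hτ' hne
      exact (hvd hτ hτ' hne).mono (hTsub τ (hvt hτ)) (hTsub τ' (hvt hτ')))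
    (fun τ => ENNReal.ofReal (D τ)) _ _ _ s' _
    (by rw [Ne, ENNReal.ofReal_eq_zero, not_le]; positivity) ENNReal.ofReal_ne_top hbound
  have hτ := hvt hτv
  have hh := hfacts τ.1 hτ.1 (htρ τ hτ)
  have hDp := hDpos τ hτ
  have hsub : Metric.closedBall x s' ⊆ Metric.closedBall x0 s := by
    intro w hw
    have h1 := hTsub τ hτ hxT
    have h2 := (hz τ hτ).1
    have h3 := hτ.2.1
    have h4 := hh.2.2.1
    rw [Metric.mem_closedBall] at *
    have e1 := dist_triangle w x x0
    have e2 := dist_triangle4 x (z τ) τ.2 x0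
    rw [dist_comm (z τ)] at e2
    linarith
  have hxi : ∀ i, (Metric.closedBall (y i) (r i) ∩ Metric.closedBall x s').Nonempty →
      dist x (y i) ≤ r i + s' := by
    rintro i ⟨w, h1, h2⟩
    rw [Metric.mem_closedBall] at *
    have := dist_triangle x w (y i)
    rw [dist_comm x w] at this
    linarith
  have hmeet : ∀ i, (Metric.closedBall (y i) (r i) ∩ Metric.closedBall x s').Nonempty →
      (Metric.closedBall (y i) (r i) ∩ Metric.closedBall x0 s).Nonempty := fun i hi =>
    hi.mono (inter_subset_inter_right _ hsub)
  have hlt : ∀ i, (Metric.closedBall (y i) (r i) ∩ Metric.closedBall x s').Nonempty → r i < s' := by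
    intro i hi
    by_contra hcon
    have := hx1 ⟨i, hmeet i hi⟩ (by
      rw [Metric.mem_closedBall]
      have := hxi i hi
      push Not at hcon
      linarith)
    exact hcon this
  refine ⟨x, s', C' * K * D τ, hs', hs'ε, by positivity, hsub, ⟨?_, ?_⟩, hlt, τ.1, ?_, ?_⟩
  · intro i hi
    exact (hs'v τ hτv).2 (r i) (hr i) (hlt i hi).le
  · have h1 : ENNReal.ofReal (c * (C' * K * D τ) * s' ^ (n * m)) =
        ENNReal.ofReal (c * K * C' * s' ^ (n * m)) * ENNReal.ofReal (D τ) := by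
      rw [← ENNReal.ofReal_mul (by positivity)]
      congr 1; ring
    rw [h1]
    refine le_trans ?_ hx2
    set F : {i // (Metric.closedBall (y i) (r i) ∩ Metric.closedBall x0 s).Nonempty} → ℝ≥0∞ :=
      fun i => (Metric.closedBall (y i) (2 * s')).indicator (fun _ => ENNReal.ofReal (f (r i))) x with hF
    set j : {i // (Metric.closedBall (y i) (r i) ∩ Metric.closedBall x s').Nonempty} →
      {i // (Metric.closedBall (y i) (r i) ∩ Metric.closedBall x0 s).Nonempty} :=
      fun i => ⟨i, hmeet i i.2⟩ with hj
    have hinj : Function.Injective j := by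
      intro p q hpq
      simp only [hj, Subtype.mk.injEq] at hpq
      exact Subtype.ext hpq
    refine le_trans (le_of_eq ?_) (ENNReal.tsum_comp_le_tsum_of_injective hinj F)
    congr 1
    ext i
    have hmem : x ∈ Metric.closedBall (y i) (2 * s') := by
      rw [Metric.mem_closedBall]
      have h5 := hxi i i.2
      have h6 := hlt i i.2
      linarith
    simp only [hF, hj, indicator_of_mem hmem]
  · exact (le_max_left _ _).trans ((le_max_left _ _).trans hτ.1)
  · intro w hw j
    obtain ⟨p, hp⟩ := (hz τ hτ).2
    have := thin_of τ.1 (i0 τ.1) (hmax τ.1) b (z τ) x w p hp hxT hw (hs'v τ hτv).1 j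
    refine this.trans_eq ?_
    have h1 := ht1 τ hτ
    rw [hi0]
    field_simp


lemma core {n m : ℕ} (hn : 0 < n) (hm : 0 < m) (b : Fin m → ℝ)
    (Ψ : (Fin n → ℤ) → ℝ) (hΨ0 : ∀ a, 0 ≤ Ψ a)
    (hΨlim : ∀ ε > (0:ℝ), ∃ N : ℕ, ∀ a : Fin n → ℤ, N ≤ anorm a → Ψ a < ε)
    (f g : ℝ → ℝ) (hg : IsDimFun g)
    (hA : AntitoneOn (fun r => f r / r ^ (n * m)) (Set.Ioi 0))
    (hgdef : ∀ r > (0:ℝ), g r = f r / r ^ ((n - 1) * m))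
    (hunb : ∀ K > 0, ∃ δ > 0, ∀ r, 0 < r → r ≤ δ → K * r ^ (n * m) ≤ f r)
    (hfull : ∀ K > 0, ∀ᵐ x ∂(volume : Measure ((Fin m × Fin n) → ℝ)),
      (∀ q, x q ∈ Ico (0:ℝ) 1) → {a : Fin n → ℤ | ∀ j : Fin m,
        intDist ((∑ i, (a i : ℝ) * x (j, i)) - b j) < anorm a * fatR m g Ψ K a}.Infinite)
    {c C' : ℝ} (hc : 0 < c) (hC' : 0 < C')
    (hcc : 32 ^ (n * m) * c + 4 ^ (n * m) / C' < 1 / (2 * 10 ^ (n * m) * n ^ ((n - 1) * m)))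
    (y : ℕ → (Fin m × Fin n) → ℝ) (r : ℕ → ℝ) (hr : ∀ i, 0 < r i) {K0 : ℝ} (hK0 : 0 < K0)
    (hsmall : ∀ i, K0 * r i ^ (n * m) ≤ f (r i))
    (hsum : ∑' i, ENNReal.ofReal (f (r i)) ≤ ENNReal.ofReal (c * K0 * (1 / 4) ^ (n * m))) :
    ∃ x : (Fin m × Fin n) → ℝ, (∀ q, x q ∈ Ico (0:ℝ) 1) ∧ {a : Fin n → ℤ | ∀ j : Fin m,
        intDist ((∑ i, (a i : ℝ) * x (j, i)) - b j) < Ψ a}.Infinite ∧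
      ∀ i, x ∉ Metric.closedBall (y i) (r i) := by
  let σ := {p : ((Fin m × Fin n) → ℝ) × ℝ × ℝ // 0 < p.2.1 ∧ 0 < p.2.2 ∧
    (∀ x ∈ Metric.closedBall p.1 p.2.1, ∀ q, x q ∈ Ico (0:ℝ) 1) ∧ CubeInv f c y r p.1 p.2.1 p.2.2}
  have hstep : ∀ (k : ℕ) (p : σ), ∃ p' : σ, p'.1.2.1 ≤ 1 / ((k:ℝ) + 1) ∧
      Metric.closedBall p'.1.1 p'.1.2.1 ⊆ Metric.closedBall p.1.1 p.1.2.1 ∧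
      (∀ i, (Metric.closedBall (y i) (r i) ∩ Metric.closedBall p'.1.1 p'.1.2.1).Nonempty →
        r i < p'.1.2.1) ∧
      ∃ a : Fin n → ℤ, k ≤ anorm a ∧ ∀ w ∈ Metric.closedBall p'.1.1 p'.1.2.1, ∀ j : Fin m,
        intDist ((∑ i, (a i : ℝ) * w (j, i)) - b j) < Ψ a := by
    rintro k ⟨⟨x, s, K⟩, hs, hK, hbox, hI⟩
    obtain ⟨x', s', K', h1, h2, h3, h4, h5, h6, h7⟩ := step hn hm b Ψ hΨ0 hΨlim f g hg hA hgdef hunb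
      hfull hc hC' hcc y r hr x hs hK hbox hI k (ε := 1 / ((k:ℝ) + 1)) (by positivity)
    exact ⟨⟨⟨x', s', K'⟩, h1, h3, fun w hw => hbox w (h4 hw), h5⟩, h2, h4, h6, h7⟩
  choose F hF1 hF2 hF3 hF4 using hstep
  have hinit : ∃ p : σ, True := by
    refine ⟨⟨⟨fun _ => 1 / 2, 1 / 4, K0⟩, by norm_num, hK0, ?_, fun i _ => hsmall i, ?_⟩, trivial⟩
    · intro x hx q
      rw [Metric.mem_closedBall, dist_pi_le_iff (by norm_num)] at hx
      have := hx q
      rw [Real.dist_eq, abs_le] at this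
      constructor <;> linarith [this.1, this.2]
    · exact (ENNReal.tsum_comp_le_tsum_of_injective Subtype.val_injective
        (fun i => ENNReal.ofReal (f (r i)))).trans hsum
  obtain ⟨p0, -⟩ := hinit
  let S : ℕ → σ := fun k => Nat.rec p0 F k
  have hS : ∀ k, S (k + 1) = F k (S k) := fun k => rfl
  let Q : ℕ → Set ((Fin m × Fin n) → ℝ) := fun k => Metric.closedBall (S k).1.1 (S k).1.2.1
  obtain ⟨x, hx⟩ := IsCompact.nonempty_iInter_of_sequence_nonempty_isCompact_isClosed Q
    (fun k => by
      show Metric.closedBall (S (k+1)).1.1 (S (k+1)).1.2.1 ⊆ _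
      rw [hS]; exact hF2 k (S k))
    (fun k => ⟨_, Metric.mem_closedBall_self (S k).2.1.le⟩)
    (isCompact_closedBall _ _) (fun k => Metric.isClosed_closedBall)
  rw [mem_iInter] at hx
  refine ⟨x, (S 0).2.2.2.1 x (hx 0), ?_, ?_⟩
  · intro hfin
    obtain ⟨M, hM⟩ := (hfin.image anorm).bddAbove
    obtain ⟨a, ha, ha'⟩ := hF4 (M + 1) (S (M + 1))
    have := hM (mem_image_of_mem anorm (ha' x (by rw [← hS]; exact hx (M + 2))))
    omega
  · intro i hi
    obtain ⟨k, hk⟩ := exists_nat_one_div_lt (hr i)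
    have h1 := hF3 k (S k) i ⟨x, hi, by rw [← hS]; exact hx (k + 1)⟩
    have h2 := hF1 k (S k)
    linarith


lemma harmonic_top : ∑' k : ℕ, ENNReal.ofReal (1 / ((k:ℝ) + 1)) = ⊤ := by
  by_contra h
  have h1 := ENNReal.summable_toReal h
  have h2 : Summable (fun k : ℕ => 1 / ((k:ℝ) + 1)) := by
    refine h1.congr fun k => ?_
    rw [ENNReal.toReal_ofReal (by positivity)]
  have h3 : Summable (fun k : ℕ => 1 / (k:ℝ)) := by
    rw [← summable_nat_add_iff 1]
    simpa using h2
  exact Real.not_summable_one_div_natCast h3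

lemma shrink {n m : ℕ} (hm : 0 < m) (F : (Fin n → ℤ) → ℝ) (hF : ∀ a, 0 ≤ F a)
    (hdiv : ∑' a, ENNReal.ofReal (F a ^ m) = ⊤) :
    ∃ Ψ' : (Fin n → ℤ) → ℝ, (∀ a, 0 ≤ Ψ' a) ∧ (∀ a, Ψ' a ≤ F a) ∧
      (∀ ε > (0:ℝ), ∃ N : ℕ, ∀ a : Fin n → ℤ, N ≤ anorm a → Ψ' a < ε) ∧
      ∑' a, ENNReal.ofReal (Ψ' a ^ m) = ⊤ := by
  by_cases hlim : ∀ ε > (0:ℝ), ∃ N : ℕ, ∀ a : Fin n → ℤ, N ≤ anorm a → F a < ε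
  · exact ⟨F, hF, fun _ => le_rfl, hlim, hdiv⟩
  push Not at hlim
  obtain ⟨ε, hε, hlim⟩ := hlim
  have hinf : {a : Fin n → ℤ | ε ≤ F a}.Infinite := by
    intro hfin
    obtain ⟨M, hM⟩ := (hfin.image anorm).bddAbove
    obtain ⟨a, ha, ha'⟩ := hlim (M + 1)
    have := hM (mem_image_of_mem anorm ha')
    omega
  have := hinf.to_subtype
  let e0 := Infinite.natEmbedding {a : Fin n → ℤ | ε ≤ F a}
  let e : ℕ → (Fin n → ℤ) := fun k => (e0 k).1
  have he : Function.Injective e := Subtype.val_injective.comp e0.injective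
  have heF : ∀ k, ε ≤ F (e k) := fun k => (e0 k).2
  let w : ℕ → ℝ := fun k => ε * (1 / ((k:ℝ) + 1)) ^ (1 / (m:ℝ))
  have hw0 : ∀ k, 0 ≤ w k := fun k => by positivity
  have hwε : ∀ k, w k ≤ ε := fun k => by
    apply mul_le_of_le_one_right hε.le
    apply Real.rpow_le_one (by positivity) _ (by positivity)
    rw [div_le_one (by positivity)]
    linarith [(Nat.cast_nonneg k : (0:ℝ) ≤ k)]
  let Ψ' : (Fin n → ℤ) → ℝ := Function.extend e w 0
  have hΨe : ∀ k, Ψ' (e k) = w k := fun k => he.extend_apply w 0 k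
  have hΨn : ∀ a, (¬ ∃ k, e k = a) → Ψ' a = 0 := fun a h => by
    simp only [Ψ']; rw [Function.extend_apply' _ _ _ h]; rfl
  refine ⟨Ψ', ?_, ?_, ?_, ?_⟩
  · intro a
    by_cases h : ∃ k, e k = a
    · obtain ⟨k, rfl⟩ := h; rw [hΨe]; exact hw0 k
    · rw [hΨn a h]
  · intro a
    by_cases h : ∃ k, e k = a
    · obtain ⟨k, rfl⟩ := h; rw [hΨe]; exact (hwε k).trans (heF k)
    · rw [hΨn a h]; exact hF a
  · intro η hη
    have ht : Tendsto w atTop (nhds 0) := by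
      have h1 := (tendsto_one_div_add_atTop_nhds_zero_nat (𝕜 := ℝ)).rpow_const
        (p := 1 / (m:ℝ)) (Or.inr (by positivity))
      rw [Real.zero_rpow (by positivity)] at h1
      have h2 := h1.const_mul ε
      rw [mul_zero] at h2
      exact h2
    obtain ⟨k0, hk0⟩ := eventually_atTop.1 (ht.eventually (gt_mem_nhds hη))
    refine ⟨(Finset.range k0).sup (fun k => anorm (e k)) + 1, fun a ha => ?_⟩
    by_cases h : ∃ k, e k = a
    · obtain ⟨k, rfl⟩ := h
      rw [hΨe]
      apply hk0
      by_contra hk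
      have := Finset.le_sup (f := fun k => anorm (e k)) (Finset.mem_range.2 (not_le.1 hk))
      omega
    · rw [hΨn a h]; exact hη
  · rw [eq_top_iff]
    refine le_trans ?_ (ENNReal.tsum_comp_le_tsum_of_injective he _)
    have : ∀ k, ENNReal.ofReal (Ψ' (e k) ^ m) =
        ENNReal.ofReal (ε ^ m) * ENNReal.ofReal (1 / ((k:ℝ) + 1)) := by
      intro k
      rw [hΨe, ← ENNReal.ofReal_mul (by positivity)]
      congr 1
      simp only [w]
      rw [mul_pow, one_div (m:ℝ), Real.rpow_inv_natCast_pow (by positivity) hm.ne']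
    simp only [this]
    rw [ENNReal.tsum_mul_left, harmonic_top, ENNReal.mul_top]
    rw [Ne, ENNReal.ofReal_eq_zero, not_le]; positivity

lemma full_of_schmidt {n m : ℕ} (hm : 0 < m) (b : Fin m → ℝ)
    (Ψ : (Fin n → ℤ) → ℝ) (hΨ0 : ∀ a, 0 ≤ Ψ a)
    (schmidt : ∀ Ψ' : (Fin n → ℤ) → ℝ, (∀ a, 0 ≤ Ψ' a) →
      (∀ ε > (0:ℝ), ∃ N : ℕ, ∀ a : Fin n → ℤ, N ≤ anorm a → Ψ' a < ε) →
      (∑' a : Fin n → ℤ, ENNReal.ofReal (Ψ' a ^ m) = ⊤) →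
      volume (box n m \ W n m b Ψ') = 0)
    (g : ℝ → ℝ) (hg : IsDimFun g)
    (hdiv : ∑' a : {a : Fin n → ℤ // a ≠ 0},
        ENNReal.ofReal (g (Ψ a.1 / (anorm a.1 : ℝ)) * (anorm a.1 : ℝ) ^ m) = ⊤)
    (K : ℝ) (hK : 0 < K) : ∀ᵐ x ∂(volume : Measure ((Fin m × Fin n) → ℝ)),
      (∀ q, x q ∈ Ico (0:ℝ) 1) → {a : Fin n → ℤ | ∀ j : Fin m,
        intDist ((∑ i, (a i : ℝ) * x (j, i)) - b j) < anorm a * fatR m g Ψ K a}.Infinite := by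
  have hgn : ∀ a, 0 ≤ g (Ψ a / anorm a) := fun a =>
    hg.2.2.1 _ (div_nonneg (hΨ0 a) (Nat.cast_nonneg _))
  obtain ⟨Ψ', h0, hle, hlim, htop⟩ := shrink hm (fun a => anorm a * fatR m g Ψ K a)
    (fun a => mul_nonneg (Nat.cast_nonneg _) (Real.rpow_nonneg (div_nonneg (hgn a) hK.le) _)) (by
      rw [eq_top_iff]
      refine le_trans ?_ (ENNReal.tsum_comp_le_tsum_of_injective
        (Subtype.val_injective (p := fun a : Fin n → ℤ => a ≠ 0)) _)
      have : ∀ a : {a : Fin n → ℤ // a ≠ 0},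
          ENNReal.ofReal ((anorm a.1 * fatR m g Ψ K a.1) ^ m) =
          ENNReal.ofReal (g (Ψ a.1 / (anorm a.1 : ℝ)) * (anorm a.1 : ℝ) ^ m) *
            ENNReal.ofReal (1 / K) := by
        intro a
        rw [← ENNReal.ofReal_mul (mul_nonneg (hgn _) (by positivity))]
        congr 1
        unfold fatR
        rw [mul_pow, one_div, Real.rpow_inv_natCast_pow (div_nonneg (hgn _) hK.le) hm.ne']
        ring
      simp only [this]
      rw [ENNReal.tsum_mul_right, hdiv, ENNReal.top_mul]
      rw [Ne, ENNReal.ofReal_eq_zero, not_le]; positivity)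
  have hs := schmidt Ψ' h0 hlim htop
  have hae : ∀ᵐ X ∂(volume : Measure (EuclideanSpace ℝ (Fin m × Fin n))),
      X ∈ box n m → X ∈ W n m b Ψ' := by
    rw [ae_iff]
    convert hs using 2
    ext X
    simp
  have := (PiLp.volume_preserving_toLp (Fin m × Fin n)).quasiMeasurePreserving.ae hae
  filter_upwards [this] with x hx hxb
  refine (hx hxb).2.mono ?_
  intro a ha j
  exact (ha j).trans_le (hle a)


lemma IsDimFun.zero {f : ℝ → ℝ} (hf : IsDimFun f) : f 0 = 0 := by
  obtain ⟨-, h2, h3, h4⟩ := hf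
  apply le_antisymm _ (h3 0 le_rfl)
  refine ge_of_tendsto h4 ?_
  filter_upwards [self_mem_nhdsWithin] with r hr
  exact h2 (mem_Ici.2 le_rfl) (mem_Ici.2 (le_of_lt hr)) (le_of_lt hr)

lemma W_subset_box {n m : ℕ} (b : Fin m → ℝ) (Ψ : (Fin n → ℤ) → ℝ) : W n m b Ψ ⊆ box n m :=
  fun _ h => h.1

lemma sum_top_of_bdd {n m : ℕ} (hn : 0 < n)
    (Ψ : (Fin n → ℤ) → ℝ) (hΨ0 : ∀ a, 0 ≤ Ψ a)
    (hΨlim : ∀ ε > (0:ℝ), ∃ N : ℕ, ∀ a : Fin n → ℤ, N ≤ anorm a → Ψ a < ε)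
    (f g : ℝ → ℝ) (hg : IsDimFun g)
    (hgdef : ∀ r > (0:ℝ), g r = f r / r ^ ((n - 1) * m))
    (hdiv : ∑' a : {a : Fin n → ℤ // a ≠ 0},
        ENNReal.ofReal (g (Ψ a.1 / (anorm a.1 : ℝ)) * (anorm a.1 : ℝ) ^ m) = ⊤)
    {M : ℝ} (hM : 0 < M) (hbd : ∀ r, 0 < r → r ≤ 1 → f r ≤ M * r ^ (n * m)) :
    ∑' a : Fin n → ℤ, ENNReal.ofReal (Ψ a ^ m) = ⊤ := by
  by_contra hne
  obtain ⟨N, hN⟩ := hΨlim 1 one_pos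
  let T : (Fin n → ℤ) → ℝ≥0∞ := fun a =>
    ENNReal.ofReal (g (Ψ a / (anorm a : ℝ)) * (anorm a : ℝ) ^ m)
  have hfin := finite_anorm_lt (n := n) (N + 1)
  let S := hfin.toFinset
  let T1 : (Fin n → ℤ) → ℝ≥0∞ := fun a => if a ∈ S then T a else 0
  have hle : ∀ a, T a ≤ T1 a + ENNReal.ofReal M * ENNReal.ofReal (Ψ a ^ m) := by
    intro a
    by_cases ha : a ∈ S
    · simp only [T1, if_pos ha]; exact le_self_add
    · simp only [T1, if_neg ha, zero_add]
      have haN : N + 1 ≤ anorm a := by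
        simp only [S, Finite.mem_toFinset, mem_setOf_eq, not_lt] at ha
        exact_mod_cast ha
      rw [← ENNReal.ofReal_mul hM.le]
      apply ENNReal.ofReal_le_ofReal
      have hapos : (0:ℝ) < anorm a := by
        have : 0 < anorm a := by omega
        exact_mod_cast this
      have ha1 : (1:ℝ) ≤ anorm a := by
        have : 1 ≤ anorm a := by omega
        exact_mod_cast this
      rcases (hΨ0 a).eq_or_lt with h0 | hpos
      · rw [← h0, zero_div, hg.zero, zero_mul]
        positivity
      · have hu : 0 < Ψ a / anorm a := div_pos hpos hapos
        have hu1 : Ψ a / anorm a ≤ 1 := by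
          rw [div_le_one hapos]
          exact (hN a (by omega)).le.trans ha1
        have h1 : g (Ψ a / anorm a) ≤ M * (Ψ a / anorm a) ^ m := by
          rw [hgdef _ hu, div_le_iff₀ (by positivity)]
          refine (hbd _ hu hu1).trans (le_of_eq ?_)
          rw [nm_eq hn, pow_add]; ring
        calc g (Ψ a / anorm a) * (anorm a : ℝ) ^ m
            ≤ M * (Ψ a / anorm a) ^ m * (anorm a : ℝ) ^ m := by gcongr
          _ = M * Ψ a ^ m := by rw [mul_assoc, ← mul_pow, div_mul_cancel₀ _ hapos.ne']
  have h1 : ∑' a, T a ≤ ∑' a, T1 a + ENNReal.ofReal M * ∑' a, ENNReal.ofReal (Ψ a ^ m) := by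
    rw [← ENNReal.tsum_mul_left, ← ENNReal.tsum_add]
    exact ENNReal.tsum_le_tsum hle
  have h2 : ∑' a, T1 a ≠ ⊤ := by
    rw [tsum_eq_sum (s := S) (fun a ha => by simp only [T1, if_neg ha])]
    rw [Ne, ENNReal.sum_eq_top]
    rintro ⟨a, ha, hta⟩
    simp only [T1, if_pos ha, T] at hta
    exact ENNReal.ofReal_ne_top hta
  have h3 : ∑' a, T a = ⊤ := by
    rw [eq_top_iff, ← hdiv]
    exact ENNReal.tsum_comp_le_tsum_of_injective
        (Subtype.val_injective (p := fun a : Fin n → ℤ => a ≠ 0)) T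
  rw [h3, top_le_iff, ENNReal.add_eq_top] at h1
  rcases h1 with h1 | h1
  · exact h2 h1
  · exact ENNReal.mul_ne_top ENNReal.ofReal_ne_top hne h1

lemma hMeasure_null {ι : Type*} [Fintype ι] (f : ℝ → ℝ) (hι : 0 < Fintype.card ι) (hf0 : f 0 = 0)
    {M : ℝ} (hM : 0 < M) (hbd : ∀ r, 0 < r → r ≤ 1 → f r ≤ M * r ^ (Fintype.card ι))
    (s : Set (EuclideanSpace ℝ ι)) (hs : volume s = 0) : hMeasure f s = 0 := by
  have h1 : (hMeasure f : Measure (EuclideanSpace ℝ ι)) ≤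
      ENNReal.ofReal M • μH[(Fintype.card ι : ℝ)] := by
    unfold hMeasure Measure.hausdorffMeasure
    apply Measure.mkMetric_mono_smul ENNReal.ofReal_ne_top
    · rw [Ne, ENNReal.ofReal_eq_zero, not_le]; exact hM
    · have : ∀ᶠ d : ℝ≥0∞ in nhdsWithin 0 (Ici 0), d < 1 :=
        nhdsWithin_le_nhds (Iio_mem_nhds one_pos)
      filter_upwards [this] with d hd
      have hdt : d ≠ ⊤ := (hd.trans ENNReal.one_lt_top).ne
      simp only [Pi.smul_apply, smul_eq_mul, ENNReal.rpow_natCast]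
      rcases eq_or_ne d 0 with rfl | hd0
      · simp [hf0]
      · have hdp := ENNReal.toReal_pos hd0 hdt
        have hd1 : d.toReal ≤ 1 := by
          have := ENNReal.toReal_mono ENNReal.one_ne_top hd.le
          simpa using this
        refine (ENNReal.ofReal_le_ofReal (hbd _ hdp hd1)).trans (le_of_eq ?_)
        rw [ENNReal.ofReal_mul hM.le, ENNReal.ofReal_pow hdp.le, ENNReal.ofReal_toReal hdt]
  have h2 : μH[(Fintype.card ι : ℝ)] s = 0 := by
    have hs' : s = (WithLp.toLp 2) '' ((WithLp.toLp 2 : (ι → ℝ) → EuclideanSpace ℝ ι) ⁻¹' s) := by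
      rw [image_preimage_eq]
      intro x
      exact ⟨WithLp.ofLp x, rfl⟩
    have hv : volume ((WithLp.toLp 2 : (ι → ℝ) → EuclideanSpace ℝ ι) ⁻¹' s) = 0 :=
      (PiLp.volume_preserving_toLp ι).quasiMeasurePreserving.preimage_null hs
    rw [hs']
    have h3 := (PiLp.lipschitzWith_toLp 2 (fun _ : ι => ℝ)).hausdorffMeasure_image_le
      (d := (Fintype.card ι : ℝ)) (Nat.cast_nonneg _)
      ((WithLp.toLp 2 : (ι → ℝ) → EuclideanSpace ℝ ι) ⁻¹' s)
    rw [hausdorffMeasure_pi_real, hv, mul_zero] at h3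
    exact le_antisymm h3 bot_le
  have h3 := h1 s
  rw [Measure.smul_apply, h2, smul_zero] at h3
  exact le_antisymm h3 bot_le

lemma caseB {n m : ℕ} (hn : 0 < n) (hm : 0 < m) (b : Fin m → ℝ)
    (Ψ : (Fin n → ℤ) → ℝ) (hΨ0 : ∀ a, 0 ≤ Ψ a)
    (hΨlim : ∀ ε > (0:ℝ), ∃ N : ℕ, ∀ a : Fin n → ℤ, N ≤ anorm a → Ψ a < ε)
    (f g : ℝ → ℝ) (hf : IsDimFun f) (hg : IsDimFun g)
    (hA : AntitoneOn (fun r => f r / r ^ (n * m)) (Set.Ioi 0))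
    (hgdef : ∀ r > (0:ℝ), g r = f r / r ^ ((n - 1) * m))
    (hunb : ∀ K > 0, ∃ δ > 0, ∀ r, 0 < r → r ≤ δ → K * r ^ (n * m) ≤ f r)
    (hfull : ∀ K > 0, ∀ᵐ x ∂(volume : Measure ((Fin m × Fin n) → ℝ)),
      (∀ q, x q ∈ Ico (0:ℝ) 1) → {a : Fin n → ℤ | ∀ j : Fin m,
        intDist ((∑ i, (a i : ℝ) * x (j, i)) - b j) < anorm a * fatR m g Ψ K a}.Infinite) :
    hMeasure f (W n m b Ψ) = ⊤ := by
  by_contra hne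
  let H := (hMeasure f (W n m b Ψ)).toReal
  have hH : hMeasure f (W n m b Ψ) = ENNReal.ofReal H := (ENNReal.ofReal_toReal hne).symm
  have hH0 : 0 ≤ H := ENNReal.toReal_nonneg
  have hn' : (0:ℝ) < n := by exact_mod_cast hn
  obtain ⟨c1, hc1⟩ : ∃ c1 : ℝ, c1 = 1 / (2 * 10 ^ (n * m) * n ^ ((n - 1) * m)) := ⟨_, rfl⟩
  have hc1p : 0 < c1 := by rw [hc1]; positivity
  obtain ⟨c, hc⟩ : ∃ c : ℝ, c = c1 / (4 * 32 ^ (n * m)) := ⟨_, rfl⟩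
  have hcp : 0 < c := by rw [hc]; positivity
  obtain ⟨C', hC⟩ : ∃ C' : ℝ, C' = 4 * 4 ^ (n * m) / c1 := ⟨_, rfl⟩
  have hCp : 0 < C' := by rw [hC]; positivity
  have hcc : 32 ^ (n * m) * c + 4 ^ (n * m) / C' < 1 / (2 * 10 ^ (n * m) * n ^ ((n - 1) * m)) := by
    rw [← hc1]
    have : 32 ^ (n * m) * c + 4 ^ (n * m) / C' = c1 / 2 := by
      rw [hc, hC]; field_simp; norm_num
    rw [this]; linarith
  obtain ⟨K0, hK0⟩ : ∃ K0 : ℝ, K0 = (H + 2) / (c * (1 / 4) ^ (n * m)) := ⟨_, rfl⟩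
  have hK0p : 0 < K0 := by rw [hK0]; positivity
  have hK0e : c * K0 * (1 / 4) ^ (n * m) = H + 2 := by
    rw [hK0]; field_simp
  obtain ⟨δ, hδ, hδK⟩ := hunb K0 hK0p
  -- extract a cover
  have hlt : (⨅ (t : ℕ → Set (EuclideanSpace ℝ (Fin m × Fin n))) (_ : W n m b Ψ ⊆ iUnion t)
      (_ : ∀ k, Metric.ediam (t k) ≤ ENNReal.ofReal (δ / 2)),
      ∑' k, ⨆ _ : (t k).Nonempty, ENNReal.ofReal (f (Metric.ediam (t k)).toReal)) <
      ENNReal.ofReal (H + 1) := by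
    refine lt_of_le_of_lt ?_ ((ENNReal.ofReal_lt_ofReal_iff (by linarith)).2 (lt_add_one H))
    rw [← hH]
    unfold hMeasure
    rw [Measure.mkMetric_apply]
    exact le_iSup₂ (f := fun (r : ℝ≥0∞) (_ : 0 < r) =>
      ⨅ (t : ℕ → Set (EuclideanSpace ℝ (Fin m × Fin n))) (_ : W n m b Ψ ⊆ iUnion t)
      (_ : ∀ k, Metric.ediam (t k) ≤ r),
      ∑' k, ⨆ _ : (t k).Nonempty, ENNReal.ofReal (f (Metric.ediam (t k)).toReal))
      (ENNReal.ofReal (δ / 2)) (ENNReal.ofReal_pos.2 (by linarith))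
  simp only [iInf_lt_iff] at hlt
  obtain ⟨t, hcov, hdiam, hsum⟩ := hlt
  obtain ⟨ε, hε, hεs⟩ := ENNReal.exists_pos_sum_of_countable (ε := 1) one_ne_zero ℕ
  have hsel : ∀ k, ∃ (y : (Fin m × Fin n) → ℝ) (r : ℝ), 0 < r ∧ r ≤ δ ∧
      ENNReal.ofReal (f r) ≤ (⨆ _ : (t k).Nonempty,
        ENNReal.ofReal (f (Metric.ediam (t k)).toReal)) + ε k ∧
      ∀ X ∈ t k, WithLp.ofLp X ∈ Metric.closedBall y r := by
    classical
    intro k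
    have hdne : Metric.ediam (t k) ≠ ⊤ := ne_top_of_le_ne_top ENNReal.ofReal_ne_top (hdiam k)
    obtain ⟨d, hd⟩ : ∃ d : ℝ, d = (if (t k).Nonempty then (Metric.ediam (t k)).toReal else 0) :=
      ⟨_, rfl⟩
    have hd0 : 0 ≤ d := by
      rw [hd]; split_ifs
      · exact ENNReal.toReal_nonneg
      · exact le_rfl
    have hdδ : d ≤ δ / 2 := by
      rw [hd]; split_ifs
      · exact ENNReal.toReal_le_of_le_ofReal (by linarith) (hdiam k)
      · linarith
    have hfd : ENNReal.ofReal (f d) = ⨆ _ : (t k).Nonempty,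
        ENNReal.ofReal (f (Metric.ediam (t k)).toReal) := by
      by_cases h : (t k).Nonempty
      · simp [hd, h]
      · simp [hd, h, hf.zero]
    have hcont : ContinuousWithinAt f (Ioi d) d :=
      (hf.1 d hd0).mono (fun x hx => hd0.trans (le_of_lt hx))
    have hev : ∀ᶠ r in nhdsWithin d (Ioi d), f r < f d + ε k :=
      hcont.eventually (gt_mem_nhds (by have := hε k; linarith [NNReal.coe_pos.2 this]))
    have hev2 : ∀ᶠ r in nhdsWithin d (Ioi d), r < δ :=
      nhdsWithin_le_nhds (Iio_mem_nhds (by linarith))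
    obtain ⟨r, hr1, hr2, hr3⟩ := (hev.and (hev2.and self_mem_nhdsWithin)).exists
    have hr3' : d < r := hr3
    have hfr : ENNReal.ofReal (f r) ≤ (⨆ _ : (t k).Nonempty,
        ENNReal.ofReal (f (Metric.ediam (t k)).toReal)) + ε k := by
      rw [← hfd]
      refine (ENNReal.ofReal_le_ofReal hr1.le).trans ?_
      rw [ENNReal.ofReal_add (hf.2.2.1 d hd0) (NNReal.coe_nonneg _), ENNReal.ofReal_coe_nnreal]
    by_cases h : (t k).Nonempty
    · obtain ⟨Y, hY⟩ := h
      refine ⟨WithLp.ofLp Y, r, hd0.trans_lt hr3, hr2.le, hfr, fun X hX => ?_⟩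
      have h1 : edist X Y ≤ Metric.ediam (t k) := Metric.edist_le_ediam_of_mem hX hY
      have h2 : dist X Y ≤ d := by
        rw [hd, if_pos ⟨Y, hY⟩, dist_edist]
        exact ENNReal.toReal_mono hdne h1
      have h3 : dist (WithLp.ofLp X) (WithLp.ofLp Y) ≤ dist X Y := by
        have := (PiLp.lipschitzWith_ofLp 2 (fun _ : Fin m × Fin n => ℝ)).dist_le_mul X Y
        simpa using this
      rw [Metric.mem_closedBall]
      linarith
    · refine ⟨0, r, hd0.trans_lt hr3, hr2.le, hfr, fun X hX => absurd ⟨X, hX⟩ h⟩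
  choose y r hr hrδ hfr hball using hsel
  have hsumf : ∑' i, ENNReal.ofReal (f (r i)) ≤ ENNReal.ofReal (c * K0 * (1 / 4) ^ (n * m)) := by
    rw [hK0e]
    calc ∑' i, ENNReal.ofReal (f (r i)) ≤ ∑' i, ((⨆ _ : (t i).Nonempty,
          ENNReal.ofReal (f (Metric.ediam (t i)).toReal)) + ε i) := ENNReal.tsum_le_tsum hfr
      _ = (∑' i, (⨆ _ : (t i).Nonempty,
          ENNReal.ofReal (f (Metric.ediam (t i)).toReal))) + ∑' i, (ε i : ℝ≥0∞) :=
          ENNReal.tsum_add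
      _ ≤ ENNReal.ofReal (H + 1) + 1 := add_le_add hsum.le hεs.le
      _ = ENNReal.ofReal (H + 2) := by
          rw [← ENNReal.ofReal_one, ← ENNReal.ofReal_add (by linarith) zero_le_one]
          congr 1; ring
  obtain ⟨x, hx1, hx2, hx3⟩ := core hn hm b Ψ hΨ0 hΨlim f g hg hA hgdef hunb hfull hcp hCp hcc y r
    hr hK0p (fun i => hδK _ (hr i) (hrδ i)) hsumf
  have hxW : (WithLp.toLp 2 x : EuclideanSpace ℝ (Fin m × Fin n)) ∈ W n m b Ψ := ⟨hx1, hx2⟩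
  obtain ⟨i, hi⟩ := mem_iUnion.1 (hcov hxW)
  exact hx3 i (hball i _ hi)

theorem stmt10 {n m : ℕ} (hn : 0 < n) (hm : 0 < m) (hnm : 2 < n + m) (b : Fin m → ℝ)
    (Ψ : (Fin n → ℤ) → ℝ) (hΨ0 : ∀ a, 0 ≤ Ψ a)
    (hΨlim : ∀ ε > (0:ℝ), ∃ N : ℕ, ∀ a : Fin n → ℤ, N ≤ anorm a → Ψ a < ε)
    -- Schmidt's theorem (divergent part), taken as a hypothesis:
    (schmidt : ∀ Ψ' : (Fin n → ℤ) → ℝ, (∀ a, 0 ≤ Ψ' a) →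
      (∀ ε > (0:ℝ), ∃ N : ℕ, ∀ a : Fin n → ℤ, N ≤ anorm a → Ψ' a < ε) →
      (∑' a : Fin n → ℤ, ENNReal.ofReal (Ψ' a ^ m) = ⊤) →
      volume (box n m \ W n m b Ψ') = 0)
    (f g : ℝ → ℝ) (hf : IsDimFun f) (hg : IsDimFun g)
    (hmono : MonotoneOn (fun r => f r / r ^ (n * m)) (Set.Ioi 0) ∨
      AntitoneOn (fun r => f r / r ^ (n * m)) (Set.Ioi 0))
    (hgdef : ∀ r > (0:ℝ), g r = f r / r ^ ((n - 1) * m))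
    (hdiv : ∑' a : {a : Fin n → ℤ // a ≠ 0},
        ENNReal.ofReal (g (Ψ a.1 / (anorm a.1 : ℝ)) * (anorm a.1 : ℝ) ^ m) = ⊤) :
    hMeasure f (W n m b Ψ) = hMeasure f (box n m) := by
  have hbounded : (∃ M > 0, ∀ r, 0 < r → r ≤ 1 → f r ≤ M * r ^ (n * m)) →
      hMeasure f (W n m b Ψ) = hMeasure f (box n m) := by
    rintro ⟨M, hM, hbd⟩
    have h1 := schmidt Ψ hΨ0 hΨlim
      (sum_top_of_bdd hn Ψ hΨ0 hΨlim f g hg hgdef hdiv hM hbd)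
    have hcard : Fintype.card (Fin m × Fin n) = n * m := by simp [mul_comm]
    have h2 := hMeasure_null (ι := Fin m × Fin n) f (by rw [hcard]; positivity) hf.zero hM
      (by rw [hcard]; exact hbd) _ h1
    apply le_antisymm (measure_mono (W_subset_box b Ψ))
    calc hMeasure f (box n m) ≤ hMeasure f (W n m b Ψ ∪ (box n m \ W n m b Ψ)) :=
          measure_mono (fun x hx => by by_cases h : x ∈ W n m b Ψ
                                       · exact Or.inl h
                                       · exact Or.inr ⟨hx, h⟩)
      _ ≤ hMeasure f (W n m b Ψ) + hMeasure f (box n m \ W n m b Ψ) := measure_union_le _ _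
      _ = hMeasure f (W n m b Ψ) := by rw [h2, add_zero]
  rcases hmono with hmo | hA
  · apply hbounded
    refine ⟨f 1 + 1, by linarith [hf.2.2.1 1 zero_le_one], fun r hr hr1 => ?_⟩
    have h := hmo (mem_Ioi.2 hr) (mem_Ioi.2 one_pos) hr1
    simp only [one_pow, div_one] at h
    rw [div_le_iff₀ (by positivity)] at h
    have : 0 ≤ r ^ (n * m) := by positivity
    linarith
  · by_cases hunb : ∀ K > 0, ∃ δ > 0, ∀ r, 0 < r → r ≤ δ → K * r ^ (n * m) ≤ f r
    · have h := caseB hn hm b Ψ hΨ0 hΨlim f g hf hg hA hgdef hunb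
        (full_of_schmidt hm b Ψ hΨ0 schmidt g hg hdiv)
      rw [h, eq_comm, eq_top_iff, ← h]
      exact measure_mono (W_subset_box b Ψ)
    · apply hbounded
      push Not at hunb
      obtain ⟨K, hK, h⟩ := hunb
      refine ⟨K, hK, fun s hs _ => ?_⟩
      obtain ⟨r, hr, hrs, hfr⟩ := h s hs
      have h2 := hA (mem_Ioi.2 hr) (mem_Ioi.2 hs) hrs
      simp only at h2
      have h3 : f r / r ^ (n * m) < K := by rwa [div_lt_iff₀ (by positivity)]
      have h4 := h2.trans h3.le
      rwa [div_le_iff₀ (by positivity)] at h4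
end

section
/- Let (Bᵢ) be a sequence of balls in ℝ^m with radii r(Bᵢ) → 0. Let f be a dimension function such that r^{-m} f(r) is monotonic and let Ω be a ball in ℝ^m. Suppose that for every ball B contained in Ω, H^m(B ∩ limsup Bᵢ^f) = H^m(B), where Bᵢ^f := B(xᵢ, f(rᵢ)^{1/m}) for Bᵢ = B(xᵢ, rᵢ). Then for every ball B in Ω, H^f(B ∩ limsup Bᵢ) = H^f(B). -/
open MeasureTheory Set Filter
open scoped ENNReal

lemma mtp_haar {m : ℕ} (μ : Measure (EuclideanSpace ℝ (Fin m))) [μ.IsAddHaarMeasure]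
    (x : EuclideanSpace ℝ (Fin m)) {s : ℝ} (hs : 0 ≤ s) :
    μ (Metric.closedBall x s) = ENNReal.ofReal (s ^ m) * μ (Metric.ball 0 1) := by
  rw [Measure.addHaar_closedBall μ x hs]; simp

/-- covering: volume of a ball bounded by the volumes of a countable cover -/
lemma mtp_cover {m : ℕ} {ι : Type*} [Countable ι]
    (y : EuclideanSpace ℝ (Fin m)) {s : ℝ} (hs : 0 ≤ s)
    (μ : Measure (EuclideanSpace ℝ (Fin m))) [μ.IsAddHaarMeasure]
    (N : Set (EuclideanSpace ℝ (Fin m))) (hN : μ N = 0)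
    (u : ι → EuclideanSpace ℝ (Fin m)) (d : ι → ℝ) (hd : ∀ k, 0 ≤ d k)
    (h : Metric.closedBall y s ⊆ N ∪ ⋃ k, Metric.closedBall (u k) (d k)) :
    ENNReal.ofReal (s ^ m) ≤ ∑' k, ENNReal.ofReal (d k ^ m) := by
  have hv0 : μ (Metric.ball 0 1) ≠ 0 := (Metric.measure_ball_pos μ _ one_pos).ne'
  have hv1 : μ (Metric.ball 0 1) ≠ ⊤ := measure_ball_lt_top.ne
  have h1 : μ (Metric.closedBall y s) ≤ ∑' k, μ (Metric.closedBall (u k) (d k)) := by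
    calc μ (Metric.closedBall y s) ≤ μ (N ∪ ⋃ k, Metric.closedBall (u k) (d k)) := measure_mono h
      _ ≤ μ N + μ (⋃ k, Metric.closedBall (u k) (d k)) := measure_union_le _ _
      _ ≤ _ := by rw [hN, zero_add]; exact measure_iUnion_le _
  simp_rw [mtp_haar μ _ hs, mtp_haar μ _ (hd _), ENNReal.tsum_mul_right] at h1
  exact (ENNReal.mul_le_mul_iff_left hv0 hv1).1 h1

/-- packing -/
lemma mtp_pack {m : ℕ} (y : EuclideanSpace ℝ (Fin m)) {s : ℝ} (hs : 0 ≤ s)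
    (T : Finset ℕ) (c : ℕ → EuclideanSpace ℝ (Fin m)) (R : ℕ → ℝ) (hR : ∀ i ∈ T, 0 ≤ R i)
    (hdisj : (T : Set ℕ).PairwiseDisjoint fun i => Metric.closedBall (c i) (R i))
    (hsub : ∀ i ∈ T, Metric.closedBall (c i) (R i) ⊆ Metric.closedBall y s) :
    ∑ i ∈ T, R i ^ m ≤ s ^ m := by
  let μ : Measure (EuclideanSpace ℝ (Fin m)) := volume
  have hv0 : μ (Metric.ball 0 1) ≠ 0 := (Metric.measure_ball_pos μ _ one_pos).ne'
  have hv1 : μ (Metric.ball 0 1) ≠ ⊤ := measure_ball_lt_top.ne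
  have h1 : ∑ i ∈ T, μ (Metric.closedBall (c i) (R i)) ≤ μ (Metric.closedBall y s) := by
    rw [← measure_biUnion_finset hdisj (fun i _ => Metric.isClosed_closedBall.measurableSet)]
    exact measure_mono (iUnion₂_subset hsub)
  rw [mtp_haar μ _ hs, Finset.sum_congr rfl (fun i hi => mtp_haar μ (c i) (hR i hi)),
    ← Finset.sum_mul, ← ENNReal.ofReal_sum_of_nonneg (fun i hi => pow_nonneg (hR i hi) _)] at h1
  have := (ENNReal.mul_le_mul_iff_left hv0 hv1).1 h1
  exact (ENNReal.ofReal_le_ofReal_iff (pow_nonneg hs _)).1 this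

/-- Cassels' lemma: scaling radii by a constant does not change a limsup set, a.e. -/
lemma mtp_cassels {m : ℕ} (μ : Measure (EuclideanSpace ℝ (Fin m))) [μ.IsAddHaarMeasure]
    (c : ℕ → EuclideanSpace ℝ (Fin m)) (R : ℕ → ℝ) (hR : Tendsto R atTop (nhds 0))
    {M : ℝ} (hM : 0 < M) (Ω : Set (EuclideanSpace ℝ (Fin m)))
    (h : μ (Ω \ {y | {i | y ∈ Metric.ball (c i) (R i)}.Infinite}) = 0) :
    μ (Ω \ {y | {i | y ∈ Metric.ball (c i) (M * R i)}.Infinite}) = 0 := by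
  have key := blimsup_thickening_mul_ae_eq μ (fun _ => True) (fun i => {c i}) hM R hR
  have e : ∀ Q : ℕ → ℝ, (blimsup (fun i => Metric.thickening (Q i) {c i}) atTop (fun _ => True)
      : Set (EuclideanSpace ℝ (Fin m))) = {y | {i | y ∈ Metric.ball (c i) (Q i)}.Infinite} := by
    intro Q
    ext y
    simp [Filter.mem_limsup_iff_frequently_mem, Nat.frequently_atTop_iff_infinite]
  rw [e, e] at key
  rw [measure_congr ((ae_eq_refl Ω).diff key)]
  exact h

/-- Vitali-type selection inside a ball. -/
lemma mtp_select {m : ℕ} (μ : Measure (EuclideanSpace ℝ (Fin m))) [μ.IsAddHaarMeasure]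
    (c : ℕ → EuclideanSpace ℝ (Fin m)) (R : ℕ → ℝ) (hRpos : ∀ i, 0 < R i)
    (hR : Tendsto R atTop (nhds 0)) (Ω : Set (EuclideanSpace ℝ (Fin m)))
    (h : μ (Ω \ {y | {i | y ∈ Metric.ball (c i) (R i)}.Infinite}) = 0)
    (y : EuclideanSpace ℝ (Fin m)) {s : ℝ} (hs : 0 < s) (hy : Metric.closedBall y s ⊆ Ω)
    (p : ℕ → Prop) (hp : ∀ᶠ i in atTop, p i) :
    ∃ T : Finset ℕ, (∀ i ∈ T, p i ∧ Metric.closedBall (c i) (R i) ⊆ Metric.closedBall y s) ∧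
      ((T : Set ℕ).PairwiseDisjoint fun i => Metric.closedBall (c i) (R i)) ∧
      s ^ m / (2 * 10 ^ m) ≤ ∑ i ∈ T, R i ^ m := by
  classical
  let t : Set ℕ := {i | (p i ∧ Metric.closedBall (c i) (R i) ⊆ Metric.closedBall y s) ∧ R i ≤ s / 4}
  obtain ⟨u, hut, hud, huc⟩ := Vitali.exists_disjoint_subfamily_covering_enlargement_closedBall
    t c R (s / 4) (fun a ha => ha.2) 5 (by norm_num)
  have hcov : Metric.closedBall y (s / 2) ⊆
      (Ω \ {y | {i | y ∈ Metric.ball (c i) (R i)}.Infinite}) ∪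
        ⋃ k : u, Metric.closedBall (c k) (5 * R k) := by
    intro w hw
    by_cases hG : {i | w ∈ Metric.ball (c i) (R i)}.Infinite
    · right
      have hev : ∀ᶠ i in atTop, p i ∧ R i ≤ s / 4 :=
        hp.and ((hR.eventually (gt_mem_nhds (by positivity : (0:ℝ) < s / 4))).mono
          fun i hi => le_of_lt hi)
      obtain ⟨i, hwi, hpi, hRi⟩ :=
        ((Nat.frequently_atTop_iff_infinite.2 hG).and_eventually hev).exists
      have hit : i ∈ t := by
        refine ⟨⟨hpi, ?_⟩, hRi⟩
        apply Metric.closedBall_subset_closedBall'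
        have h1 : dist w (c i) < R i := hwi
        have h2 : dist w y ≤ s / 2 := hw
        have := dist_triangle_left (c i) y w
        linarith
      obtain ⟨b, hb, hsub⟩ := huc i hit
      exact mem_iUnion.2 ⟨⟨b, hb⟩, hsub (Metric.ball_subset_closedBall hwi)⟩
    · left
      exact ⟨hy (Metric.closedBall_subset_closedBall (by linarith) hw), hG⟩
  have h1 := mtp_cover y (by positivity : 0 ≤ s / 2) μ _ h (fun k : u => c k)
    (fun k : u => 5 * R k) (fun k => by have := hRpos k; positivity) hcov
  have h2 : ENNReal.ofReal ((s / 10) ^ m) ≤ ∑' k : u, ENNReal.ofReal (R k ^ m) := by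
    have e : ∀ k : u, ENNReal.ofReal ((5 * R k) ^ m)
        = ENNReal.ofReal (5 ^ m) * ENNReal.ofReal (R k ^ m) := fun k => by
      rw [mul_pow, ENNReal.ofReal_mul (by positivity)]
    have e2 : (s / 2) ^ m = 5 ^ m * (s / 10) ^ m := by rw [← mul_pow]; congr 1; ring
    simp_rw [e, ENNReal.tsum_mul_left] at h1
    rw [e2, ENNReal.ofReal_mul (by positivity)] at h1
    exact (ENNReal.mul_le_mul_iff_right (by simp) (by simp)).1 h1
  have h3 : ENNReal.ofReal (s ^ m / (2 * 10 ^ m)) < ∑' k : u, ENNReal.ofReal (R k ^ m) := by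
    refine lt_of_lt_of_le ?_ h2
    rw [ENNReal.ofReal_lt_ofReal_iff (by positivity), div_pow]
    rw [div_lt_div_iff₀ (by positivity) (by positivity)]
    have : 0 < s ^ m * 10 ^ m := by positivity
    nlinarith
  rw [ENNReal.tsum_eq_iSup_sum, lt_iSup_iff] at h3
  obtain ⟨S, hS⟩ := h3
  refine ⟨S.map (Function.Embedding.subtype _), ?_, ?_, ?_⟩
  · intro i hi
    obtain ⟨hiu, -⟩ := by simpa using hi
    exact (hut hiu).1
  · refine hud.subset ?_
    intro i hi
    obtain ⟨hiu, -⟩ := by simpa using hi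
    exact hiu
  · rw [Finset.sum_map]
    rw [← ENNReal.ofReal_sum_of_nonneg (f := fun i : u => R i ^ m)
      (fun i _ => pow_nonneg (hRpos i).le _)] at hS
    exact ((ENNReal.ofReal_lt_ofReal_iff_of_nonneg (by positivity)).1 hS).le

/-- Content lower bound. -/
def MtpCon {m : ℕ} (f : ℝ → ℝ) (X : Set (EuclideanSpace ℝ (Fin m))) (a : ℝ) : Prop :=
  ∀ U : ℕ → Set (EuclideanSpace ℝ (Fin m)), (∀ k, Bornology.IsBounded (U k)) →
    X ⊆ ⋃ k, U k → ENNReal.ofReal a ≤ ∑' k, ENNReal.ofReal (f (Metric.diam (U k)))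

lemma mtp_big {m : ℕ} {f : ℝ → ℝ} (hfm : MonotoneOn f (Set.Ici 0)) {q a : ℝ} (hq : 0 ≤ q)
    (ha : a ≤ f q) (U : ℕ → Set (EuclideanSpace ℝ (Fin m))) (k : ℕ)
    (hk : q < Metric.diam (U k)) :
    ENNReal.ofReal a ≤ ∑' k, ENNReal.ofReal (f (Metric.diam (U k))) :=
  le_trans (ENNReal.ofReal_le_ofReal (ha.trans (hfm hq (hq.trans hk.le) hk.le)))
    (ENNReal.le_tsum k)

lemma mtp_base {m : ℕ} {f : ℝ → ℝ} (hfm : MonotoneOn f (Set.Ici 0)) {q κ : ℝ} (hq : 0 < q)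
    (hfq : 0 ≤ f q) (hκ : κ ≤ (1 / 2) ^ m)
    (hanti : ∀ d, 0 ≤ d → d ≤ q → f q / q ^ m * d ^ m ≤ f d)
    (y : EuclideanSpace ℝ (Fin m)) :
    MtpCon f (Metric.closedBall y (q / 2)) (κ * f q) := by
  intro U hb hU
  have hκ1 : (1 / 2 : ℝ) ^ m ≤ 1 := pow_le_one₀ (by norm_num) (by norm_num)
  by_cases hex : ∃ k, q < Metric.diam (U k)
  · obtain ⟨k, hk⟩ := hex
    refine mtp_big hfm hq.le ?_ U k hk
    nlinarith
  push Not at hex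
  have : ∀ k, ∃ u, U k ⊆ Metric.closedBall u (Metric.diam (U k)) := by
    intro k
    rcases (U k).eq_empty_or_nonempty with h | ⟨u, hu⟩
    · exact ⟨0, by simp [h]⟩
    · exact ⟨u, fun w hw => Metric.dist_le_diam_of_mem (hb k) hw hu⟩
  choose u hu using this
  have h1 := mtp_cover y (by positivity : 0 ≤ q / 2) volume ∅ (by simp) u
    (fun k => Metric.diam (U k)) (fun k => Metric.diam_nonneg)
    (by rw [empty_union]; exact hU.trans (iUnion_mono hu))
  calc ENNReal.ofReal (κ * f q) ≤ ENNReal.ofReal (f q / q ^ m * (q / 2) ^ m) := by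
        apply ENNReal.ofReal_le_ofReal
        have : f q / q ^ m * (q / 2) ^ m = (1 / 2) ^ m * f q := by
          rw [div_pow, div_pow]; field_simp; simp
        rw [this]
        exact mul_le_mul_of_nonneg_right hκ hfq
    _ = ENNReal.ofReal (f q / q ^ m) * ENNReal.ofReal ((q / 2) ^ m) :=
        ENNReal.ofReal_mul (by positivity)
    _ ≤ ENNReal.ofReal (f q / q ^ m) * ∑' k, ENNReal.ofReal (Metric.diam (U k) ^ m) := by gcongr
    _ = ∑' k, ENNReal.ofReal (f q / q ^ m * Metric.diam (U k) ^ m) := by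
        rw [← ENNReal.tsum_mul_left]
        congr 1; ext k; rw [ENNReal.ofReal_mul (by positivity)]
    _ ≤ _ := ENNReal.tsum_le_tsum fun k =>
        ENNReal.ofReal_le_ofReal (hanti _ Metric.diam_nonneg (hex k))

lemma mtp_step {m : ℕ} {f : ℝ → ℝ} (hfm : MonotoneOn f (Set.Ici 0)) (hf0 : f 0 = 0)
    {q σ : ℝ} (hq : 0 < q)
    (hfq : 0 ≤ f q) (hσ : 0 ≤ σ) (hσ1 : σ ≤ 1)
    (hanti : ∀ d, 0 ≤ d → d ≤ q → f q / q ^ m * d ^ m ≤ f d)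
    (T : Finset ℕ) (c : ℕ → EuclideanSpace ℝ (Fin m)) (r R : ℕ → ℝ)
    (hr : ∀ i ∈ T, 0 < r i ∧ r i ≤ R i)
    (hdisj : (T : Set ℕ).PairwiseDisjoint fun i => Metric.closedBall (c i) (R i))
    (hsum : σ * q ^ m ≤ ∑ i ∈ T, R i ^ m)
    (X : ℕ → Set (EuclideanSpace ℝ (Fin m)))
    (hX : ∀ i ∈ T, X i ⊆ Metric.closedBall (c i) (r i / 2))
    (hcon : ∀ i ∈ T, MtpCon f (X i) ((1 / 5) ^ m * (f q / q ^ m) * R i ^ m)) :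
    MtpCon f (⋃ i ∈ T, X i) ((1 / 5) ^ m * σ * f q) := by
  classical
  intro U hb hU
  have h51 : (1 / 5 : ℝ) ^ m ≤ 1 := pow_le_one₀ (by norm_num) (by norm_num)
  have h50 : (0 : ℝ) < (1 / 5 : ℝ) ^ m := by positivity
  by_cases hex : ∃ k, q < Metric.diam (U k)
  · obtain ⟨k, hk⟩ := hex
    refine mtp_big hfm hq.le ?_ U k hk
    have : (1 / 5 : ℝ) ^ m * σ ≤ 1 := mul_le_one₀ h51 hσ hσ1
    nlinarith
  push Not at hex
  set a : ℝ := (1 / 5) ^ m * (f q / q ^ m) with ha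
  have ha0 : 0 ≤ a := by positivity
  -- children met by the `k`-th set
  let S : ℕ → Finset ℕ := fun k => T.filter fun i => (U k ∩ X i).Nonempty
  let F : ℕ → ℕ → ℝ≥0∞ := fun k i => if i ∈ S k then
    (if 1 < (S k).card then ENNReal.ofReal (a * R i ^ m)
      else ENNReal.ofReal (f (Metric.diam (U k)))) else 0
  have hrow : ∀ k, ∑ i ∈ T, F k i ≤ ENNReal.ofReal (f (Metric.diam (U k))) := by
    intro k
    have e : ∑ i ∈ T, F k i = ∑ i ∈ S k, F k i :=
      (Finset.sum_subset (Finset.filter_subset _ _) (fun i _ hi => if_neg hi)).symm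
    rw [e]
    by_cases hc : 1 < (S k).card
    · have e2 : ∑ i ∈ S k, F k i = ∑ i ∈ S k, ENNReal.ofReal (a * R i ^ m) :=
        Finset.sum_congr rfl fun i hi => by simp only [F, if_pos hi, if_pos hc]
      have hS : ∀ i ∈ S k, i ∈ T ∧ (U k ∩ X i).Nonempty := fun i hi => Finset.mem_filter.1 hi
      have hRpos : ∀ i ∈ S k, 0 < R i := fun i hi =>
        (hr i (hS i hi).1).1.trans_le (hr i (hS i hi).1).2
      rw [e2, ← ENNReal.ofReal_sum_of_nonneg
        (fun i hi => mul_nonneg ha0 (pow_nonneg (hRpos i hi).le _)), ← Finset.mul_sum]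
      apply ENNReal.ofReal_le_ofReal
      obtain ⟨i0, hi0⟩ : (S k).Nonempty := Finset.card_pos.1 (by omega)
      obtain ⟨u, huU, -⟩ := (hS i0 hi0).2
      have hd0 : 0 ≤ Metric.diam (U k) := Metric.diam_nonneg
      have hpack : ∑ i ∈ S k, R i ^ m ≤ (5 * Metric.diam (U k)) ^ m := by
        refine mtp_pack u (by positivity) (S k) c R (fun i hi => (hRpos i hi).le)
          (hdisj.subset (by intro i hi; exact (hS i hi).1)) ?_
        intro i hi
        obtain ⟨j, hj, hji⟩ := Finset.exists_mem_ne hc i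
        obtain ⟨p, hpU, hpX⟩ := (hS i hi).2
        obtain ⟨w, hwU, hwX⟩ := (hS j hj).2
        have hp1 : dist p (c i) ≤ r i / 2 := hX i (hS i hi).1 hpX
        have hw1 : dist w (c j) ≤ r j / 2 := hX j (hS j hj).1 hwX
        have hwE : w ∈ Metric.closedBall (c j) (R j) := by
          have := hr j (hS j hj).1
          exact Metric.mem_closedBall.2 (by linarith)
        have hwn : w ∉ Metric.closedBall (c i) (R i) := fun hw' =>
          (Set.disjoint_left.1 (hdisj (hS j hj).1 (hS i hi).1 hji)) hwE hw'
        have hwn' : R i < dist w (c i) := by simpa using hwn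
        have hpw : dist w p ≤ Metric.diam (U k) := Metric.dist_le_diam_of_mem (hb k) hwU hpU
        have hpu : dist p u ≤ Metric.diam (U k) := Metric.dist_le_diam_of_mem (hb k) hpU huU
        have htri := dist_triangle w p (c i)
        have htri2 := dist_triangle_left (c i) u p
        have := hr i (hS i hi).1
        apply Metric.closedBall_subset_closedBall'
        linarith
      calc a * ∑ i ∈ S k, R i ^ m ≤ a * (5 * Metric.diam (U k)) ^ m := by gcongr
        _ = f q / q ^ m * Metric.diam (U k) ^ m := by
            rw [ha, mul_pow, div_pow]; field_simp; simp
        _ ≤ _ := hanti _ hd0 (hex k)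
    · have e2 : ∑ i ∈ S k, F k i = ∑ i ∈ S k, ENNReal.ofReal (f (Metric.diam (U k))) :=
        Finset.sum_congr rfl fun i hi => by simp only [F, if_pos hi, if_neg hc]
      rw [e2, Finset.sum_const]
      calc (S k).card • ENNReal.ofReal (f (Metric.diam (U k)))
          ≤ 1 • ENNReal.ofReal (f (Metric.diam (U k))) := by
            apply nsmul_le_nsmul_left (by simp) (by omega)
        _ = _ := one_smul _ _
  have hcol : ∀ i ∈ T, ENNReal.ofReal (a * R i ^ m) ≤ ∑' k, F k i := by
    intro i hi
    by_cases hB : ∃ k, i ∈ S k ∧ 1 < (S k).card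
    · obtain ⟨k, hk, hc⟩ := hB
      refine le_trans (le_of_eq ?_) (ENNReal.le_tsum k)
      simp only [F, if_pos hk, if_pos hc]
    · push Not at hB
      refine le_trans (hcon i hi (fun k => if i ∈ S k then U k else ∅) ?_ ?_) ?_
      · intro k
        split_ifs
        · exact hb k
        · exact Bornology.isBounded_empty
      · intro w hw
        obtain ⟨k, hk⟩ := mem_iUnion.1 (hU (mem_iUnion₂.2 ⟨i, hi, hw⟩))
        have : i ∈ S k := Finset.mem_filter.2 ⟨hi, w, hk, hw⟩
        exact mem_iUnion.2 ⟨k, by simpa only [if_pos this] using hk⟩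
      · refine ENNReal.tsum_le_tsum fun k => ?_
        by_cases hk : i ∈ S k
        · simp only [F, if_pos hk, if_neg (not_lt.2 (hB k hk)), le_refl]
        · simp [F, if_neg hk, hf0]
  calc ENNReal.ofReal ((1 / 5) ^ m * σ * f q) ≤ ENNReal.ofReal (∑ i ∈ T, a * R i ^ m) := by
        apply ENNReal.ofReal_le_ofReal
        rw [← Finset.mul_sum]
        have : (1 / 5) ^ m * σ * f q = a * (σ * q ^ m) := by
          rw [ha]; field_simp
        rw [this]
        exact mul_le_mul_of_nonneg_left hsum ha0
    _ = ∑ i ∈ T, ENNReal.ofReal (a * R i ^ m) :=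
        ENNReal.ofReal_sum_of_nonneg fun i hi =>
          mul_nonneg ha0 (pow_nonneg ((hr i hi).1.le.trans (hr i hi).2) _)
    _ ≤ ∑ i ∈ T, ∑' k, F k i := Finset.sum_le_sum hcol
    _ = ∑' k, ∑ i ∈ T, F k i := (Summable.tsum_finsetSum fun i _ => ENNReal.summable).symm
    _ ≤ _ := ENNReal.tsum_le_tsum hrow

lemma mtp_limit {m : ℕ} {f : ℝ → ℝ} (hfc : ContinuousOn f (Set.Ici 0)) (hf0 : f 0 = 0) {a : ℝ}
    (Y : ℕ → Set (EuclideanSpace ℝ (Fin m))) (hY : Antitone Y) (hYc : ∀ n, IsCompact (Y n))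
    (hcon : ∀ n, MtpCon f (Y n) a) : ENNReal.ofReal a ≤ hMeasure f (⋂ n, Y n) := by
  unfold hMeasure
  rw [Measure.mkMetric_apply]
  refine le_iSup₂_of_le 1 one_pos ?_
  refine le_iInf₂ fun t ht => le_iInf fun hd => ?_
  have hsimp : ∀ n, (⨆ _ : (t n).Nonempty, ENNReal.ofReal (f (Metric.ediam (t n)).toReal))
      = ENNReal.ofReal (f (Metric.diam (t n))) := by
    intro n
    rcases (t n).eq_empty_or_nonempty with h | h
    · simp [h, hf0]
    · simp only [h, iSup_pos]; rfl
  simp_rw [hsimp]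
  refine ENNReal.le_of_forall_pos_le_add fun ε hε _ => ?_
  obtain ⟨ε', hε', hsum⟩ := ENNReal.exists_pos_sum_of_countable
    (ε := (ε : ℝ≥0∞)) (by simpa using hε.ne') ℕ
  have hex : ∀ k, ∃ U : Set (EuclideanSpace ℝ (Fin m)), IsOpen U ∧ t k ⊆ U ∧
      Bornology.IsBounded U ∧ f (Metric.diam U) ≤ f (Metric.diam (t k)) + ε' k := by
    intro k
    have hbk : Bornology.IsBounded (t k) :=
      Metric.isBounded_iff_ediam_ne_top.2 ((hd k).trans_lt ENNReal.one_lt_top).ne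
    obtain ⟨δ, hδ, hδf⟩ := Metric.continuousOn_iff.1 hfc (Metric.diam (t k)) Metric.diam_nonneg
      (ε' k) (hε' k)
    refine ⟨Metric.thickening (δ / 4) (t k), Metric.isOpen_thickening,
      Metric.self_subset_thickening (by positivity) _, hbk.thickening, ?_⟩
    have h1 := Metric.diam_thickening_le (t k) (by positivity : 0 ≤ δ / 4)
    have h2 := Metric.diam_mono (Metric.self_subset_thickening (by positivity : 0 < δ / 4) (t k))
      hbk.thickening
    have h3 := hδf (Metric.diam (Metric.thickening (δ / 4) (t k))) Metric.diam_nonneg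
      (by rw [Real.dist_eq, abs_lt]; constructor <;> linarith)
    rw [Real.dist_eq, abs_lt] at h3
    linarith [h3.2]
  choose U hUo htU hUb hUf using hex
  obtain ⟨n, hn⟩ := exists_subset_nhds_of_isCompact (V := Y) (U := ⋃ k, U k)
    (directed_of_isDirected_le fun i j hij => hY hij) hYc
    (fun x hx => (isOpen_iUnion hUo).mem_nhds (iUnion_mono htU (ht hx)))
  calc ENNReal.ofReal a ≤ ∑' k, ENNReal.ofReal (f (Metric.diam (U k))) := hcon n U hUb hn
    _ ≤ ∑' k, (ENNReal.ofReal (f (Metric.diam (t k))) + ε' k) := by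
        refine ENNReal.tsum_le_tsum fun k => ?_
        refine (ENNReal.ofReal_le_ofReal (hUf k)).trans (ENNReal.ofReal_add_le.trans ?_)
        simp
    _ = ∑' k, ENNReal.ofReal (f (Metric.diam (t k))) + ∑' k, (ε' k : ℝ≥0∞) := ENNReal.tsum_add
    _ ≤ _ := by gcongr

/-- The Cantor type approximations. -/
def MtpX {α : Type*} (T : ℕ → Finset ℕ) (D : ℕ → Set α) : ℕ → ℕ → Set α
  | 0, j => D j
  | n + 1, j => ⋃ i ∈ T j, MtpX T D n i

/-- The main case: `f t / t ^ m → ∞`. -/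
lemma mtp_main {m : ℕ} (hm : 0 < m) (c : ℕ → EuclideanSpace ℝ (Fin m)) (r : ℕ → ℝ)
    (hr0 : ∀ i, 0 < r i) (hrlim : Tendsto r atTop (nhds 0))
    (f : ℝ → ℝ) (hfc : ContinuousOn f (Set.Ici 0)) (hfm : MonotoneOn f (Set.Ici 0))
    (hf0 : f 0 = 0) (hfpos : ∀ t, 0 < t → 0 < f t)
    (hanti : AntitoneOn (fun t => f t / t ^ m) (Set.Ioi 0))
    (hinf : ∀ K : ℝ, ∃ t0 > 0, K ≤ f t0 / t0 ^ m)
    (μ : Measure (EuclideanSpace ℝ (Fin m))) [μ.IsAddHaarMeasure]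
    (Ω : Set (EuclideanSpace ℝ (Fin m)))
    (H : μ (Ω \ {y | {i | y ∈ Metric.ball (c i) ((f (r i)) ^ ((1:ℝ) / m))}.Infinite}) = 0)
    (x : EuclideanSpace ℝ (Fin m)) (t : ℝ) (ht : 0 < t) (hx : Metric.ball x t ⊆ Ω) :
    hMeasure f (Metric.ball x t ∩ {y | {i | y ∈ Metric.ball (c i) (r i)}.Infinite}) = ⊤ := by
  classical
  have hm' : (m : ℝ) ≠ 0 := by positivity
  have hfr : Tendsto (fun i => f (r i)) atTop (nhds 0) := by
    have h1 : Tendsto f (nhdsWithin 0 (Set.Ici 0)) (nhds 0) := by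
      have := hfc 0 (by simp)
      rwa [ContinuousWithinAt, hf0] at this
    exact h1.comp (tendsto_nhdsWithin_iff.2 ⟨hrlim, Eventually.of_forall fun i => (hr0 i).le⟩)
  let R : ℝ → ℕ → ℝ := fun K i => (f (r i) / K) ^ ((1:ℝ) / m)
  have hRpos : ∀ K, 0 < K → ∀ i, 0 < R K i := fun K hK i =>
    Real.rpow_pos_of_pos (div_pos (hfpos _ (hr0 i)) hK) _
  have hRpow : ∀ K, 0 < K → ∀ i, R K i ^ m = f (r i) / K := fun K hK i => by
    have h0 : 0 ≤ f (r i) / K := (div_pos (hfpos _ (hr0 i)) hK).le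
    simp only [R]
    rw [← Real.rpow_natCast, ← Real.rpow_mul h0, one_div, inv_mul_cancel₀ hm', Real.rpow_one]
  have hRlim : ∀ K, Tendsto (R K) atTop (nhds 0) := fun K => by
    have h1 : Tendsto (fun i => f (r i) / K) atTop (nhds 0) := by simpa using hfr.div_const K
    have h2 := h1.rpow_const (p := (1:ℝ) / m) (Or.inr (by positivity))
    rwa [Real.zero_rpow (by positivity)] at h2
  have hRfull : ∀ K, 0 < K → μ (Ω \ {y | {i | y ∈ Metric.ball (c i) (R K i)}.Infinite}) = 0 := by
    intro K hK
    have h1 : Tendsto (fun i => f (r i) ^ ((1:ℝ) / m)) atTop (nhds 0) := by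
      have h2 := hfr.rpow_const (p := (1:ℝ) / m) (Or.inr (by positivity))
      rwa [Real.zero_rpow (by positivity)] at h2
    have h3 := mtp_cassels μ c _ h1 (M := (1 / K) ^ ((1:ℝ) / m)) (by positivity) Ω H
    have e : ∀ i, (1 / K) ^ ((1:ℝ) / m) * f (r i) ^ ((1:ℝ) / m) = R K i := fun i => by
      rw [← Real.mul_rpow (by positivity) (hfpos _ (hr0 i)).le]
      simp only [R]; congr 1; ring
    simpa only [e] using h3
  have hRge : ∀ K, 0 < K → ∀ᶠ i in atTop, r i ≤ R K i := by
    intro K hK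
    obtain ⟨t0, ht0, hKt⟩ := hinf K
    filter_upwards [hrlim.eventually (gt_mem_nhds ht0)] with i hi
    have h1 : K ≤ f (r i) / r i ^ m := hKt.trans (hanti (hr0 i) ht0 hi.le)
    refine le_of_pow_le_pow_left₀ hm.ne' (hRpos K hK i).le ?_
    rw [hRpow K hK]
    rw [le_div_iff₀ (pow_pos (hr0 i) m)] at h1
    rw [le_div_iff₀ hK]
    linarith
  -- selection of children
  have hsel : ∀ K, 0 < K → ∀ y s, 0 < s → Metric.closedBall y s ⊆ Ω → ∀ N : ℕ,
      ∃ T : Finset ℕ, (∀ i ∈ T, (N < i ∧ r i ≤ R K i) ∧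
        Metric.closedBall (c i) (R K i) ⊆ Metric.closedBall y s) ∧
      ((T : Set ℕ).PairwiseDisjoint fun i => Metric.closedBall (c i) (R K i)) ∧
      s ^ m / (2 * 10 ^ m) ≤ ∑ i ∈ T, R K i ^ m := fun K hK y s hs hy N =>
    mtp_select μ c (R K) (hRpos K hK) (hRlim K) Ω (hRfull K hK) y hs hy _
      ((eventually_gt_atTop N).and (hRge K hK))
  let D : ℕ → Set (EuclideanSpace ℝ (Fin m)) := fun j => Metric.closedBall (c j) (r j / 2)
  let σ : ℝ := 1 / (2 * 20 ^ m)
  have hσ0 : 0 < σ := by positivity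
  have h20 : (1:ℝ) ≤ 20 ^ m := one_le_pow₀ (by norm_num)
  have hσ1 : σ ≤ 1 := by
    rw [div_le_one (by positivity)]; linarith
  let κ : ℝ := (1 / 5) ^ m * σ
  have hκ0 : 0 < κ := by positivity
  let K : ℕ → ℝ := fun j => f (r j) / r j ^ m / σ
  have hK : ∀ j, 0 < K j := fun j =>
    div_pos (div_pos (hfpos _ (hr0 j)) (pow_pos (hr0 j) m)) hσ0
  have hT : ∀ j, ∃ T : Finset ℕ, D j ⊆ Ω → (∀ i ∈ T, (j < i ∧ r i ≤ R (K j) i) ∧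
        Metric.closedBall (c i) (R (K j) i) ⊆ D j) ∧
      ((T : Set ℕ).PairwiseDisjoint fun i => Metric.closedBall (c i) (R (K j) i)) ∧
      σ * r j ^ m ≤ ∑ i ∈ T, R (K j) i ^ m := by
    intro j
    by_cases hj : D j ⊆ Ω
    · obtain ⟨T, h1, h2, h3⟩ := hsel (K j) (hK j) (c j) (r j / 2) (half_pos (hr0 j)) hj j
      refine ⟨T, fun _ => ⟨h1, h2, le_trans (le_of_eq ?_) h3⟩⟩
      have : (20:ℝ) ^ m = 2 ^ m * 10 ^ m := by rw [← mul_pow]; norm_num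
      simp only [σ]
      rw [div_pow, this]; field_simp
    · exact ⟨∅, fun h => absurd h hj⟩
  choose T hT using hT
  have hDE : ∀ K', (0:ℝ) < K' → ∀ i, r i ≤ R K' i → D i ⊆ Metric.closedBall (c i) (R K' i) :=
    fun K' hK' i hi => Metric.closedBall_subset_closedBall (by linarith [hr0 i])
  have hDsub : ∀ j, D j ⊆ Ω → ∀ i ∈ T j, D i ⊆ D j := fun j hj i hi =>
    (hDE _ (hK j) i ((hT j hj).1 i hi).1.2).trans ((hT j hj).1 i hi).2
  let X := MtpX T D
  have hXD : ∀ n j, D j ⊆ Ω → X n j ⊆ D j := by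
    intro n
    induction n with
    | zero => intro j _; exact subset_rfl
    | succ n ih =>
      intro j hj
      exact iUnion₂_subset fun i hi =>
        (ih i ((hDsub j hj i hi).trans hj)).trans (hDsub j hj i hi)
  have hXanti : ∀ n j, D j ⊆ Ω → X (n + 1) j ⊆ X n j := by
    intro n
    induction n with
    | zero => intro j hj; exact hXD 1 j hj
    | succ n ih =>
      intro j hj
      exact iUnion₂_mono fun i hi => ih i ((hDsub j hj i hi).trans hj)
  have hXc : ∀ n j, IsCompact (X n j) := by
    intro n
    induction n with
    | zero => intro j; exact isCompact_closedBall _ _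
    | succ n ih => intro j; exact (T j).isCompact_biUnion fun i _ => ih i
  have hXmem : ∀ n j, D j ⊆ Ω → ∀ y ∈ X n j, ∃ i, j + n ≤ i ∧ y ∈ D i := by
    intro n
    induction n with
    | zero => intro j _ y hy; exact ⟨j, le_rfl, hy⟩
    | succ n ih =>
      intro j hj y hy
      obtain ⟨i, hi, hy⟩ := mem_iUnion₂.1 hy
      obtain ⟨k, hk, hyk⟩ := ih i ((hDsub j hj i hi).trans hj) y hy
      have := ((hT j hj).1 i hi).1.1
      exact ⟨k, by omega, hyk⟩
  have hlow : ∀ j d, 0 ≤ d → d ≤ r j → f (r j) / r j ^ m * d ^ m ≤ f d := by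
    intro j d hd hdr
    rcases hd.eq_or_lt with rfl | hd
    · simp [hf0, hm.ne']
    · have := hanti hd (hr0 j) hdr
      exact (le_div_iff₀ (pow_pos hd m)).1 this
  have hXcon : ∀ n j, D j ⊆ Ω → MtpCon f (X n j) (κ * f (r j)) := by
    intro n
    induction n with
    | zero =>
      intro j hj
      refine mtp_base hfm (hr0 j) (hfpos _ (hr0 j)).le ?_ (hlow j) (c j)
      calc κ ≤ (1 / 5) ^ m * 1 := mul_le_mul_of_nonneg_left hσ1 (by positivity)
        _ ≤ (1 / 2) ^ m := by
          rw [mul_one]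
          exact pow_le_pow_left₀ (by norm_num) (by norm_num) m
    | succ n ih =>
      intro j hj
      obtain ⟨h1, h2, h3⟩ := hT j hj
      refine mtp_step hfm hf0 (hr0 j) (hfpos _ (hr0 j)).le hσ0.le hσ1 (hlow j) (T j) c r (R (K j))
        (fun i hi => ⟨hr0 i, (h1 i hi).1.2⟩) h2 h3 (X n)
        (fun i hi => hXD n i ((hDsub j hj i hi).trans hj)) ?_
      intro i hi
      have := ih i ((hDsub j hj i hi).trans hj)
      convert this using 1
      rw [hRpow _ (hK j)]
      have h5 := hfpos _ (hr0 j)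
      have h6 := hr0 j
      simp only [K, κ]
      field_simp
  let Z : ℕ → Set (EuclideanSpace ℝ (Fin m)) := fun j => ⋂ n, X n j
  have hZ : ∀ j, D j ⊆ Ω → ENNReal.ofReal (κ * f (r j)) ≤ hMeasure f (Z j) := fun j hj =>
    mtp_limit hfc hf0 (fun n => X n j) (antitone_nat_of_succ_le fun n => hXanti n j hj)
      (fun n => hXc n j) (fun n => hXcon n j hj)
  have hZS : ∀ j, D j ⊆ Ω → Z j ⊆ {y | {i | y ∈ Metric.ball (c i) (r i)}.Infinite} := by
    intro j hj y hy
    refine Nat.frequently_atTop_iff_infinite.1 (frequently_atTop.2 fun N => ?_)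
    obtain ⟨i, hi, hyi⟩ := hXmem N j hj y (mem_iInter.1 hy N)
    exact ⟨i, by omega, Metric.closedBall_subset_ball (half_lt_self (hr0 i)) hyi⟩
  -- conclusion
  have hfin : ∀ L : ℝ, 0 < L → ENNReal.ofReal L ≤
      hMeasure f (Metric.ball x t ∩ {y | {i | y ∈ Metric.ball (c i) (r i)}.Infinite}) := by
    intro L hL
    set b : ℝ := (t / 2) ^ m / (2 * 10 ^ m) with hb
    have hb0 : 0 < b := by positivity
    have hxs : Metric.closedBall x (t / 2) ⊆ Metric.ball x t :=
      Metric.closedBall_subset_ball (half_lt_self ht)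
    have hK0 : 0 < L / (κ * b) := by positivity
    obtain ⟨T0, h1, h2, h3⟩ := hsel (L / (κ * b)) hK0 x (t / 2) (half_pos ht) (hxs.trans hx) 0
    have hDx : ∀ j ∈ T0, D j ⊆ Metric.ball x t := fun j hj =>
      (hDE _ hK0 j (h1 j hj).1.2).trans ((h1 j hj).2.trans hxs)
    have hZD : ∀ j ∈ T0, Z j ⊆ D j := fun j hj =>
      (iInter_subset _ 0).trans (hXD 0 j ((hDx j hj).trans hx))
    calc ENNReal.ofReal L ≤ ENNReal.ofReal (∑ j ∈ T0, κ * f (r j)) := by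
          apply ENNReal.ofReal_le_ofReal
          simp_rw [hRpow _ hK0] at h3
          rw [← Finset.sum_div, le_div_iff₀ hK0, ← hb] at h3
          rw [← Finset.mul_sum]
          calc L = κ * (b * (L / (κ * b))) := by field_simp
            _ ≤ _ := by gcongr
      _ = ∑ j ∈ T0, ENNReal.ofReal (κ * f (r j)) := ENNReal.ofReal_sum_of_nonneg fun j _ =>
          mul_nonneg hκ0.le (hfpos _ (hr0 j)).le
      _ ≤ ∑ j ∈ T0, hMeasure f (Z j) :=
          Finset.sum_le_sum fun j hj => hZ j ((hDx j hj).trans hx)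
      _ = hMeasure f (⋃ j ∈ T0, Z j) := by
          refine (measure_biUnion_finset ?_ ?_).symm
          · intro i hi j hj hij
            exact (h2 hi hj hij).mono ((hZD i hi).trans (hDE _ hK0 i (h1 i hi).1.2))
              ((hZD j hj).trans (hDE _ hK0 j (h1 j hj).1.2))
          · intro j hj
            exact (isClosed_iInter fun n => (hXc n j).isClosed).measurableSet
      _ ≤ _ := measure_mono (iUnion₂_subset fun j hj =>
          subset_inter ((hZD j hj).trans (hDx j hj)) (hZS j ((hDx j hj).trans hx)))
  refine ENNReal.eq_top_of_forall_nnreal_le fun L => ?_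
  refine le_trans ?_ (hfin (L + 1) (by positivity))
  rw [← ENNReal.ofReal_coe_nnreal]
  exact ENNReal.ofReal_le_ofReal (by simp)

/-- The Mass Transference Principle, localized to a ball `Ω = ball z ρ`. -/
theorem stmt11 {m : ℕ} (hm : 0 < m) (c : ℕ → EuclideanSpace ℝ (Fin m)) (r : ℕ → ℝ)
    (hr0 : ∀ i, 0 < r i) (hrlim : Tendsto r atTop (nhds 0))
    (f : ℝ → ℝ) (hf : IsDimFun f)
    (hmono : MonotoneOn (fun t => f t / t ^ m) (Set.Ioi 0) ∨
      AntitoneOn (fun t => f t / t ^ m) (Set.Ioi 0))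
    (z : EuclideanSpace ℝ (Fin m)) (ρ : ℝ) (hρ : 0 < ρ)
    (H : ∀ (x : EuclideanSpace ℝ (Fin m)) (t : ℝ), 0 < t →
      Metric.ball x t ⊆ Metric.ball z ρ →
      μH[(m : ℝ)] (Metric.ball x t ∩
        {y | {i | y ∈ Metric.ball (c i) ((f (r i)) ^ ((1:ℝ) / m))}.Infinite}) =
        μH[(m : ℝ)] (Metric.ball x t)) :
    ∀ (x : EuclideanSpace ℝ (Fin m)) (t : ℝ), 0 < t →
      Metric.ball x t ⊆ Metric.ball z ρ →
      hMeasure f (Metric.ball x t ∩ {y | {i | y ∈ Metric.ball (c i) (r i)}.Infinite}) =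
        hMeasure f (Metric.ball x t) := by
  obtain ⟨hfc, hfm, hfn, hft⟩ := hf
  have hf0 : f 0 = 0 := by
    have h1 : Tendsto f (nhdsWithin 0 (Set.Ioi 0)) (nhds (f 0)) :=
      (hfc 0 (by simp)).mono Ioi_subset_Ici_self
    exact tendsto_nhds_unique h1 hft
  have hm' : (m : ℝ) ≠ 0 := by positivity
  let μ : Measure (EuclideanSpace ℝ (Fin m)) := μH[(m : ℝ)]
  have hμ : μ.IsAddHaarMeasure := by
    have := MeasureTheory.isAddHaarMeasure_hausdorffMeasure (E := EuclideanSpace ℝ (Fin m))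
    rwa [finrank_euclideanSpace_fin] at this
  have hΩ : μ (Metric.ball z ρ \
      {y | {i | y ∈ Metric.ball (c i) ((f (r i)) ^ ((1:ℝ) / m))}.Infinite}) = 0 := by
    set G := {y | {i | y ∈ Metric.ball (c i) ((f (r i)) ^ ((1:ℝ) / m))}.Infinite} with hG
    have hGm : MeasurableSet G := by
      have : G = limsup (fun i => Metric.ball (c i) ((f (r i)) ^ ((1:ℝ) / m))) atTop := by
        ext y
        rw [Filter.mem_limsup_iff_frequently_mem, Nat.frequently_atTop_iff_infinite]
        rfl
      rw [this]
      exact MeasurableSet.measurableSet_limsup fun i => Metric.isOpen_ball.measurableSet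
    have h1 := H z ρ hρ subset_rfl
    have h2 : μ (Metric.ball z ρ) ≠ ⊤ := measure_ball_lt_top.ne
    have h3 := measure_sdiff_add_inter (μ := μ) (Metric.ball z ρ) hGm
    rw [show μ (Metric.ball z ρ ∩ G) = μ (Metric.ball z ρ) from h1] at h3
    by_contra hne
    exact absurd h3 (ne_of_gt (by
      rw [add_comm]; exact ENNReal.lt_add_right h2 hne))
  intro x t ht hx
  by_cases hbd : ∃ C > 0, ∃ t0 > 0, ∀ t, 0 < t → t < t0 → f t ≤ C * t ^ m
  · obtain ⟨C, hC, t0, ht0, hCt⟩ := hbd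
    have hle : hMeasure f ≤ ENNReal.ofReal C • μ := by
      refine Measure.mkMetric_mono_smul (by simp) (by simpa using hC) ?_
      have : ∀ᶠ d : ℝ≥0∞ in nhdsWithin 0 (Set.Ici 0), d < ENNReal.ofReal t0 :=
        nhdsWithin_le_nhds (gt_mem_nhds (by simpa using ht0))
      filter_upwards [this] with d hd
      have hdt : d ≠ ⊤ := (hd.trans ENNReal.ofReal_lt_top).ne
      lift d to NNReal using hdt
      simp only [ENNReal.coe_toReal, Pi.smul_apply, smul_eq_mul]
      have e : ENNReal.ofReal C * (d : ℝ≥0∞) ^ (m : ℝ) = ENNReal.ofReal (C * (d : ℝ) ^ m) := by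
        rw [ENNReal.rpow_natCast, ENNReal.ofReal_mul hC.le, ENNReal.ofReal_pow d.coe_nonneg]
        simp
      rw [e]
      apply ENNReal.ofReal_le_ofReal
      rcases (d.2 : (0:ℝ) ≤ d).eq_or_lt with h | h
      · have h' : (d : ℝ) = 0 := h.symm
        rw [h', hf0]; positivity
      · refine hCt _ h ?_
        rw [← ENNReal.ofReal_coe_nnreal] at hd
        exact (ENNReal.ofReal_lt_ofReal_iff ht0).1 hd
    set S := {y | {i | y ∈ Metric.ball (c i) (r i)}.Infinite} with hS
    have hM : 0 < C ^ ((1:ℝ) / m) := by positivity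
    have h1 : μ (Metric.ball z ρ \
        {y | {i | y ∈ Metric.ball (c i) (C ^ ((1:ℝ) / m) * r i)}.Infinite}) = 0 := by
      refine measure_mono_null (sdiff_subset_sdiff_right ?_) hΩ
      intro y hy
      refine Nat.frequently_atTop_iff_infinite.1 ?_
      refine ((Nat.frequently_atTop_iff_infinite.2 hy).and_eventually
        (hrlim.eventually (gt_mem_nhds ht0))).mono ?_
      rintro i ⟨hyi, hi⟩
      refine Metric.ball_subset_ball ?_ hyi
      calc f (r i) ^ ((1:ℝ) / m) ≤ (C * r i ^ m) ^ ((1:ℝ) / m) :=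
            Real.rpow_le_rpow (hfn _ (hr0 i).le) (hCt _ (hr0 i) hi) (by positivity)
        _ = C ^ ((1:ℝ) / m) * r i := by
            have := hr0 i
            rw [Real.mul_rpow hC.le (by positivity), ← Real.rpow_natCast, ← Real.rpow_mul this.le,
              mul_one_div_cancel hm', Real.rpow_one]
    have h2 : μ (Metric.ball z ρ \ S) = 0 := by
      have hlim : Tendsto (fun i => C ^ ((1:ℝ) / m) * r i) atTop (nhds 0) := by
        simpa using hrlim.const_mul (C ^ ((1:ℝ) / m))
      have := mtp_cassels μ c _ hlim (inv_pos.2 hM) _ h1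
      simpa only [inv_mul_cancel_left₀ hM.ne'] using this
    have h3 : hMeasure f (Metric.ball x t \ S) = 0 := by
      refine le_antisymm (le_trans (hle _) ?_) bot_le
      have h4 : μ (Metric.ball x t \ S) = 0 := measure_mono_null (sdiff_subset_sdiff_left hx) h2
      simp [h4]
    refine le_antisymm (measure_mono inter_subset_left) ?_
    calc hMeasure f (Metric.ball x t)
        ≤ hMeasure f ((Metric.ball x t ∩ S) ∪ (Metric.ball x t \ S)) := by
          rw [inter_union_sdiff]
      _ ≤ hMeasure f (Metric.ball x t ∩ S) + hMeasure f (Metric.ball x t \ S) :=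
          measure_union_le _ _
      _ = _ := by rw [h3, add_zero]
  · push Not at hbd
    have hanti : AntitoneOn (fun t => f t / t ^ m) (Set.Ioi 0) := by
      rcases hmono with h | h
      · exfalso
        obtain ⟨s, hs0, hs1, hs⟩ := hbd (f 1 + 1) (by have := hfn 1 zero_le_one; linarith) 1 one_pos
        have h1 := h hs0 (show (1:ℝ) ∈ Set.Ioi 0 from mem_Ioi.2 one_pos) hs1.le
        simp only [one_pow, div_one] at h1
        rw [div_le_iff₀ (pow_pos hs0 m)] at h1
        have := pow_pos hs0 m
        nlinarith
      · exact h
    have hfpos : ∀ t, 0 < t → 0 < f t := by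
      intro t ht
      obtain ⟨s, hs0, hs1, hs⟩ := hbd 1 one_pos t ht
      exact lt_of_lt_of_le (lt_trans (by positivity) hs) (hfm hs0.le ht.le hs1.le)
    have hinf : ∀ K : ℝ, ∃ t0 > 0, K ≤ f t0 / t0 ^ m := by
      intro K
      obtain ⟨s, hs0, hs1, hs⟩ := hbd (max K 1) (by positivity) 1 one_pos
      refine ⟨s, hs0, ?_⟩
      rw [le_div_iff₀ (pow_pos hs0 m)]
      exact le_trans (mul_le_mul_of_nonneg_right (le_max_left _ _) (pow_pos hs0 m).le) hs.le
    have htop := mtp_main hm c r hr0 hrlim f hfc hfm hf0 hfpos hanti hinf μ _ hΩ x t ht hx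
    rw [htop]
    exact (top_le_iff.1 (htop ▸ measure_mono inter_subset_left)).symm
end
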